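/- arXiv:1312.1867 — 8 statements merged into one kernel-verified Lean document; each statement's English description precedes it below -/
import Mathlib

section
/- For every positive integer k, every positive integer r, and every natural number m, the convolved k-Fibonacci number satisfies F_{k,m+1}^{(r)} = ∑_{j_1+j_2+⋯+j_r=m} F_{k,j_1+1}·F_{k,j_2+1}⋯F_{k,j_r+1}, where the sum runs over all r-tuples (j_1,…,j_r) of natural numbers with sum m. -/
/-- The `k`-Fibonacci numbers: `F_{k,0} = 0`, `F_{k,1} = 1`,
`F_{k,n+2} = k * F_{k,n+1} + F_{k,n}`. -/
def kFib (k : ℕ) : ℕ → ℕ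
  | 0 => 0
  | 1 => 1
  | n + 2 => k * kFib k (n + 1) + kFib k n

theorem kFib_gen (k : ℕ) :
    (1 - (k : PowerSeries ℤ) * PowerSeries.X - PowerSeries.X ^ 2) *
      PowerSeries.mk (fun n => (kFib k (n + 1) : ℤ)) = 1 := by
  have hc : (k : PowerSeries ℤ) = PowerSeries.C (k : ℤ) := by simp
  rw [hc, pow_two, sub_mul, sub_mul, one_mul, mul_assoc, mul_assoc]
  ext n
  rcases n with _ | _ | n
  · simp [kFib]
  · simp only [map_sub, PowerSeries.coeff_C_mul, PowerSeries.coeff_succ_X_mul]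
    simp [kFib, PowerSeries.coeff_one]
  · simp only [map_sub, PowerSeries.coeff_C_mul, PowerSeries.coeff_succ_X_mul]
    simp [kFib, PowerSeries.coeff_one]

theorem coeff_mk_pow (f : ℕ → ℤ) (r m : ℕ) :
    PowerSeries.coeff m (PowerSeries.mk f ^ r) =
      ∑ j ∈ Finset.Nat.antidiagonalTuple r m, ∏ i, f (j i) := by
  have h : PowerSeries.mk f ^ r = ∏ _i : Fin r, PowerSeries.mk f := by simp
  rw [h, PowerSeries.coeff_prod]
  refine Finset.sum_equiv Finsupp.equivFunOnFinite ?_ ?_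
  · intro l
    simp [Finset.Nat.mem_antidiagonalTuple, Finset.mem_finsuppAntidiag]
  · intro l _
    simp

/-- For positive integers `k, r` and a natural number `m`, the convolved
`k`-Fibonacci number `F_{k,m+1}^{(r)}` (where `F : ℕ → ℤ`, `F j = F_{k,j+1}^{(r)}`,
is characterized by `(1 - kx - x^2)^r · ∑_j F_{k,j+1}^{(r)} x^j = 1` in `ℤ⟦x⟧`)
equals the sum over all `r`-tuples `(j_1, …, j_r)` of natural numbers with
`j_1 + ⋯ + j_r = m` of the products `F_{k,j_1+1} ⋯ F_{k,j_r+1}`. -/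
theorem convolved_kFib_eq_sum_products (k r : ℕ) (hk : 0 < k) (hr : 0 < r) (m : ℕ)
    (F : ℕ → ℤ)
    (hF : (1 - (k : PowerSeries ℤ) * PowerSeries.X - PowerSeries.X ^ 2) ^ r *
      PowerSeries.mk F = 1) :
    F m = ∑ j ∈ Finset.Nat.antidiagonalTuple r m, ∏ i, (kFib k (j i + 1) : ℤ) := by
  set G := PowerSeries.mk (fun n => (kFib k (n + 1) : ℤ)) with hG
  have h1 := kFib_gen k
  rw [← hG] at h1
  have h2 : PowerSeries.mk F = G ^ r := by
    calc PowerSeries.mk F = ((1 - (k : PowerSeries ℤ) * PowerSeries.X - PowerSeries.X ^ 2) * G) ^ r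
          * PowerSeries.mk F := by rw [h1, one_pow, one_mul]
      _ = G ^ r * ((1 - (k : PowerSeries ℤ) * PowerSeries.X - PowerSeries.X ^ 2) ^ r *
          PowerSeries.mk F) := by rw [mul_pow]; ring
      _ = G ^ r := by rw [hF, mul_one]
  rw [← coeff_mk_pow (fun n => (kFib k (n + 1) : ℤ)), ← hG, ← h2, PowerSeries.coeff_mk]
end

section
/- For every positive integer k, every positive integer r, and every natural number j, the convolved k-Fibonacci number has the explicit form F_{k,j+1}^{(r)} = ∑_{l=0}^{⌊j/2⌋} C(j+r-l-1, j-l) · C(j-l, l) · k^{j-2l}, where C(a,b) denotes the binomial coefficient. -/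
lemma aux_step {R : Type*} [CommRing R] (t : R) (r n : ℕ) :
    (1 - t) * ∑ m ∈ Finset.range (n + 1), (((m + (r + 1) - 1).choose m : ℕ) : R) * t ^ m =
      ∑ m ∈ Finset.range (n + 1), (((m + r - 1).choose m : ℕ) : R) * t ^ m
        - (((n + r).choose n : ℕ) : R) * t ^ (n + 1) := by
  induction n with
  | zero => simp
  | succ n ih =>
    rw [Finset.sum_range_succ, mul_add, ih, Finset.sum_range_succ _ (n + 1)]
    have h1 : n + 1 + (r + 1) - 1 = (n + r) + 1 := by omega
    have h2 : n + 1 + r - 1 = n + r := by omega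
    have h3 : n + 1 + r = (n + r) + 1 := by omega
    rw [h1, h2, h3, Nat.choose_succ_succ]
    push_cast
    ring

lemma aux_dvd {R : Type*} [CommRing R] (t : R) (r n : ℕ) :
    t ^ (n + 1) ∣ (1 - t) ^ r *
      ∑ m ∈ Finset.range (n + 1), (((m + r - 1).choose m : ℕ) : R) * t ^ m - 1 := by
  induction r with
  | zero =>
    rw [Finset.sum_range_succ']
    have : ∀ m ∈ Finset.range n,
        (((m + 1 + 0 - 1).choose (m + 1) : ℕ) : R) * t ^ (m + 1) = 0 := by
      intro m _
      simp
    rw [Finset.sum_eq_zero this]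
    simp
  | succ r ih =>
    rw [pow_succ (1 - t) r, mul_assoc, aux_step]
    obtain ⟨c, hc⟩ := ih
    refine ⟨c - (1 - t) ^ r * (((n + r).choose n : ℕ) : R), ?_⟩
    linear_combination hc

lemma aux_coeff (k m j : ℕ) (hm : m ≤ j) :
    PowerSeries.coeff j (((k : PowerSeries ℤ) * PowerSeries.X + PowerSeries.X ^ 2) ^ m) =
      (k : ℤ) ^ (m - (j - m)) * (m.choose (j - m) : ℤ) := by
  obtain ⟨i, rfl⟩ := Nat.exists_eq_add_of_le hm
  have h : ((k : PowerSeries ℤ) * PowerSeries.X + PowerSeries.X ^ 2) ^ m =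
      (((Polynomial.X + Polynomial.C (k : ℤ)) ^ m : Polynomial ℤ) : PowerSeries ℤ) *
        PowerSeries.X ^ m := by
    push_cast
    rw [← mul_pow]
    congr 1
    simp
    ring
  rw [h, add_comm m i, PowerSeries.coeff_mul_X_pow, Polynomial.coeff_coe,
    Polynomial.coeff_X_add_C_pow, Nat.add_sub_cancel]

/-- For positive integers `k, r` and a natural number `j`, the convolved
`k`-Fibonacci number `F_{k,j+1}^{(r)}` (where `F : ℕ → ℤ`, `F j = F_{k,j+1}^{(r)}`,
is characterized by `(1 - kx - x^2)^r · ∑_j F_{k,j+1}^{(r)} x^j = 1` in `ℤ⟦x⟧`)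
has the explicit form
`F_{k,j+1}^{(r)} = ∑_{l=0}^{⌊j/2⌋} C(j+r-l-1, j-l) · C(j-l, l) · k^(j-2l)`. -/
theorem convolved_kFib_explicit (k r : ℕ) (hk : 0 < k) (hr : 0 < r) (j : ℕ)
    (F : ℕ → ℤ)
    (hF : (1 - (k : PowerSeries ℤ) * PowerSeries.X - PowerSeries.X ^ 2) ^ r *
      PowerSeries.mk F = 1) :
    F j = ∑ l ∈ Finset.range (j / 2 + 1),
      ((j + r - l - 1).choose (j - l) : ℤ) * ((j - l).choose l : ℤ) *
        (k : ℤ) ^ (j - 2 * l) := by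
  set t : PowerSeries ℤ := (k : PowerSeries ℤ) * PowerSeries.X + PowerSeries.X ^ 2 with ht
  have h1 : (1 - (k : PowerSeries ℤ) * PowerSeries.X - PowerSeries.X ^ 2) = 1 - t := by
    rw [ht]; ring
  rw [h1] at hF
  obtain ⟨c, hc⟩ := aux_dvd t r j
  have hX : PowerSeries.X ^ (j + 1) ∣
      ∑ m ∈ Finset.range (j + 1), (((m + r - 1).choose m : ℕ) : PowerSeries ℤ) * t ^ m
        - PowerSeries.mk F := by
    have h2 : t = PowerSeries.X * ((k : PowerSeries ℤ) + PowerSeries.X) := by rw [ht]; ring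
    have h3 : PowerSeries.X ^ (j + 1) ∣ t ^ (j + 1) := pow_dvd_pow_of_dvd ⟨_, h2⟩ _
    refine h3.trans ⟨c * PowerSeries.mk F, ?_⟩
    linear_combination (PowerSeries.mk F) * hc - (∑ m ∈ Finset.range (j + 1),
      (((m + r - 1).choose m : ℕ) : PowerSeries ℤ) * t ^ m) * hF
  have h4 := PowerSeries.X_pow_dvd_iff.mp hX j (Nat.lt_succ_self j)
  rw [map_sub, PowerSeries.coeff_mk, sub_eq_zero] at h4
  rw [← h4, map_sum, ← Finset.sum_range_reflect]
  symm
  have hsub : Finset.range (j / 2 + 1) ⊆ Finset.range (j + 1) := by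
    intro x hx
    simp only [Finset.mem_range] at *
    omega
  rw [Finset.sum_subset hsub]
  · refine Finset.sum_congr rfl fun l hl => ?_
    rw [Finset.mem_range] at hl
    have e1 : j + 1 - 1 - l = j - l := by omega
    have e2 : j - l + r - 1 = j + r - l - 1 := by omega
    have e3 : j - (j - l) = l := by omega
    have e4 : j - l - l = j - 2 * l := by omega
    rw [e1, e2, ← nsmul_eq_mul _ (t ^ (j - l)), map_nsmul, aux_coeff k (j - l) j (Nat.sub_le _ _), e3, e4,
      nsmul_eq_mul]
    ring
  · intro l hl hl'
    rw [Finset.mem_range] at hl hl'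
    rw [Nat.choose_eq_zero_of_lt (show j - l < l by omega)]
    simp
end

section
/- Fix a positive integer k. For each n, the set of k-Fibonacci paths of length n is finite; let a_n = |M_{F_{k,n}}| be its cardinality and let T = ∑_{n≥0} a_n z^n ∈ ℤ⟦z⟧. Then T satisfies the quadratic equation z^2·(1−kz−z^2)·T^2 − (1−(k+1)z−z^2)·T + (1−kz−z^2) = 0. -/
/-- A step of a (colored) lattice path: a rise `up = (1,1)`, a fall `down = (1,-1)`,
or a horizontal step `horiz l c = (l,0)` of length `l` carrying a color `c`. -/
inductive KStep where
  | up : KStep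
  | down : KStep
  | horiz (l c : ℕ) : KStep

/-- Horizontal displacement of a step. -/
def KStep.width : KStep → ℕ
  | .up => 1
  | .down => 1
  | .horiz l _ => l

/-- Height contribution of a step. -/
def KStep.ht : KStep → ℤ
  | .up => 1
  | .down => -1
  | .horiz _ _ => 0

/-- A step is valid for the parameter `k` if, when it is a horizontal step of
length `l` with color `c`, we have `l ≥ 1` and `1 ≤ c ≤ F_{k,l}`. -/
def KStep.Valid (k : ℕ) : KStep → Prop
  | .up => True
  | .down => True
  | .horiz l c => 1 ≤ l ∧ 1 ≤ c ∧ c ≤ kFib k l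

/-- Total horizontal displacement of a path. -/
def pathWidth (p : List KStep) : ℕ := (p.map KStep.width).sum

/-- Final height of a path. -/
def pathHt (p : List KStep) : ℤ := (p.map KStep.ht).sum

/-- `k`-Fibonacci paths of length `n`: valid steps, total width `n`,
all partial heights nonnegative, final height `0`. -/
def KFibPath (k n : ℕ) : Set (List KStep) :=
  {p | (∀ s ∈ p, s.Valid k) ∧ pathWidth p = n ∧
       (∀ q, q <+: p → 0 ≤ pathHt q) ∧ pathHt p = 0}

/-- Grand `k`-Fibonacci paths of length `n`: valid steps, total width `n`,
final height `0` (partial heights may be negative). -/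
def GrandKFibPath (k n : ℕ) : Set (List KStep) :=
  {p | (∀ s ∈ p, s.Valid k) ∧ pathWidth p = n ∧ pathHt p = 0}

/-- Prefix `k`-Fibonacci paths of length `n`: valid steps, total width `n`,
all partial heights nonnegative (final height arbitrary). -/
def PrefixKFibPath (k n : ℕ) : Set (List KStep) :=
  {p | (∀ s ∈ p, s.Valid k) ∧ pathWidth p = n ∧
       (∀ q, q <+: p → 0 ≤ pathHt q)}

/-- Prefix grand `k`-Fibonacci paths of length `n`: valid steps, total width `n`. -/
def PrefixGrandKFibPath (k n : ℕ) : Set (List KStep) :=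
  {p | (∀ s ∈ p, s.Valid k) ∧ pathWidth p = n}

/-- Paths started at height `h`, staying nonnegative, ending at `0`. -/
def KS (k : ℕ) (h : ℤ) (n : ℕ) : Set (List KStep) :=
  {p | (∀ s ∈ p, s.Valid k) ∧ pathWidth p = n ∧
       (∀ q, q <+: p → 0 ≤ h + pathHt q) ∧ h + pathHt p = 0}

lemma KS_nonneg {k h n p} (hp : p ∈ KS k h n) : 0 ≤ h := by
  have := hp.2.2.1 [] (List.nil_prefix)
  simpa [pathHt] using this

lemma KS_nil {k h n} : [] ∈ KS k h n ↔ h = 0 ∧ n = 0 := by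
  simp only [KS, Set.mem_ofPred_eq, pathWidth, pathHt, List.prefix_nil]
  constructor
  · rintro ⟨_, h2, _, h4⟩
    simp at h2 h4
    exact ⟨h4, h2.symm⟩
  · rintro ⟨rfl, rfl⟩
    simp

lemma KS_cons {k h n s p} : (s :: p) ∈ KS k h n ↔
    0 ≤ h ∧ s.Valid k ∧ ∃ m, s.width + m = n ∧ p ∈ KS k (h + s.ht) m := by
  constructor
  · intro hp
    refine ⟨KS_nonneg hp, ?_, pathWidth p, ?_, ?_, rfl, ?_, ?_⟩
    · exact hp.1 s (by simp)
    · simpa [pathWidth] using hp.2.1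
    · intro t ht
      exact hp.1 t (by simp [ht])
    · intro q hq
      have := hp.2.2.1 (s :: q) (by simpa using hq)
      simp [pathHt] at this ⊢
      linarith
    · have := hp.2.2.2
      simp [pathHt] at this ⊢
      linarith
  · rintro ⟨h0, hv, m, hm, h1, h2, h3, h4⟩
    refine ⟨?_, ?_, ?_, ?_⟩
    · intro t ht
      rcases List.mem_cons.1 ht with rfl | ht
      · exact hv
      · exact h1 t ht
    · simp [pathWidth] at h2 ⊢
      omega
    · intro q hq
      rcases List.prefix_cons_iff.1 hq with rfl | ⟨t, rfl, ht⟩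
      · simpa [pathHt] using h0
      · have := h3 t ht
        simp [pathHt] at this ⊢
        linarith
    · simp [pathHt] at h4 ⊢
      linarith

lemma KS_zero_sub {k h} : KS k h 0 ⊆ {[]} := by
  intro p hp
  cases p with
  | nil => rfl
  | cons s p =>
    obtain ⟨_, hv, m, hm, _⟩ := KS_cons.1 hp
    cases s <;> simp [KStep.width, KStep.Valid] at hm hv
    omega

lemma KS_finite (k : ℕ) (n : ℕ) : ∀ h, (KS k h n).Finite := by
  induction n using Nat.strong_induction_on with
  | _ n ih =>
  intro h
  rcases n with _ | n
  · exact (Set.finite_singleton _).subset KS_zero_sub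
  · have key : KS k h (n+1) ⊆ (List.cons KStep.up '' KS k (h+1) n) ∪
        ((List.cons KStep.down '' KS k (h-1) n) ∪
        ⋃ l ∈ Set.Icc 1 (n+1), ⋃ c ∈ Set.Icc 1 (kFib k l),
          (List.cons (KStep.horiz l c) '' KS k h (n+1-l))) := by
      intro p hp
      cases p with
      | nil => simp [KS_nil] at hp
      | cons s p =>
        obtain ⟨_, hv, m, hm, hp2⟩ := KS_cons.1 hp
        clear hp
        rename' hp2 => hp
        cases s with
        | up =>
          obtain rfl : m = n := by simp [KStep.width] at hm; omega
          exact Or.inl ⟨p, hp, rfl⟩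
        | down =>
          obtain rfl : m = n := by simp [KStep.width] at hm; omega
          exact Or.inr (Or.inl ⟨p, hp, rfl⟩)
        | horiz l c =>
          obtain ⟨h1, h2, h3⟩ := hv
          simp only [KStep.width, KStep.ht, add_zero] at hm hp
          obtain rfl : m = n + 1 - l := by omega
          refine Or.inr (Or.inr ?_)
          simp only [Set.mem_iUnion]
          exact ⟨l, ⟨h1, by omega⟩, c, ⟨h2, h3⟩, p, hp, rfl⟩
    refine Set.Finite.subset ?_ key
    refine ((ih n (by omega) _).image _).union (((ih n (by omega) _).image _).union ?_)
    refine (Set.finite_Icc _ _).biUnion fun l hl => (Set.finite_Icc _ _).biUnion fun c _ => ?_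
    exact (ih _ (by have := hl.1; omega) _).image _

/-- The number of such paths. -/
noncomputable def KA (k : ℕ) (h : ℤ) (n : ℕ) : ℕ := (KS_finite k n h).toFinset.card

lemma KA_neg {k h n} (hh : h < 0) : KA k h n = 0 := by
  rw [KA, Finset.card_eq_zero, Set.Finite.toFinset_eq_empty, Set.eq_empty_iff_forall_notMem]
  intro p hp
  have := KS_nonneg hp
  omega

lemma KA_zero {k h} : KA k h 0 = if h = 0 then 1 else 0 := by
  split_ifs with hh
  · rw [KA, Finset.card_eq_one]
    refine ⟨[], ?_⟩
    ext p
    simp only [Set.Finite.mem_toFinset, Finset.mem_singleton]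
    exact ⟨fun hp => KS_zero_sub hp, fun hp => by rw [hp, KS_nil]; exact ⟨hh, rfl⟩⟩
  · rw [KA, Finset.card_eq_zero, Set.Finite.toFinset_eq_empty, Set.eq_empty_iff_forall_notMem]
    intro p hp
    obtain rfl : p = [] := KS_zero_sub hp
    exact hh (KS_nil.1 hp).1

open Classical in
lemma KA_succ {k h n} (hh : 0 ≤ h) : KA k h (n+1) = KA k (h+1) n + KA k (h-1) n +
    ∑ x ∈ Finset.HasAntidiagonal.antidiagonal (n+1), kFib k x.1 * KA k h x.2 := by
  have key : (KS_finite k (n+1) h).toFinset =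
      ((KS_finite k n (h+1)).toFinset.image (List.cons KStep.up) ∪
       (KS_finite k n (h-1)).toFinset.image (List.cons KStep.down)) ∪
      (Finset.HasAntidiagonal.antidiagonal (n+1)).biUnion fun x =>
        (Finset.Icc 1 (kFib k x.1) ×ˢ (KS_finite k x.2 h).toFinset).image
          fun y => KStep.horiz x.1 y.1 :: y.2 := by
    ext p
    simp only [Set.Finite.mem_toFinset, Finset.mem_union, Finset.mem_image, Finset.mem_biUnion,
      Finset.mem_product, Finset.mem_Icc, Finset.HasAntidiagonal.mem_antidiagonal]
    cases p with
    | nil => simp [KS_nil]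
    | cons s p =>
      rw [KS_cons]
      cases s with
      | up => simp [KStep.Valid, KStep.width, KStep.ht, hh, add_comm 1]
      | down => simp [KStep.Valid, KStep.width, KStep.ht, hh, add_comm 1, sub_eq_add_neg]
      | horiz l c =>
        simp only [KStep.Valid, KStep.width, KStep.ht, hh, add_zero]
        constructor
        · rintro ⟨_, ⟨h1, h2, h3⟩, m, hm, hp⟩
          exact Or.inr ⟨(l, m), hm, (c, p), ⟨⟨h2, h3⟩, hp⟩, rfl⟩
        · rintro ((⟨q, _, hq⟩ | ⟨q, _, hq⟩) | ⟨⟨l', m⟩, hm, ⟨c', q⟩, ⟨⟨h2, h3⟩, hp⟩, hq⟩)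
          · simp at hq
          · simp at hq
          · simp only [List.cons.injEq, KStep.horiz.injEq] at hq
            obtain ⟨⟨rfl, rfl⟩, rfl⟩ := hq
            refine ⟨trivial, ⟨?_, h2, h3⟩, m, hm, hp⟩
            rcases l' with _ | l'
            · simp [kFib] at h3 h2; omega
            · omega
  rw [KA, key, Finset.card_union_of_disjoint, Finset.card_union_of_disjoint,
    Finset.card_image_of_injective _ List.cons_injective,
    Finset.card_image_of_injective _ List.cons_injective, Finset.card_biUnion]
  · congr 1
    refine Finset.sum_congr rfl fun x _ => ?_
    rw [Finset.card_image_of_injective, Finset.card_product, Nat.card_Icc]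
    · simp [KA]
    · rintro ⟨a, b⟩ ⟨c, d⟩ hq
      simpa using hq
  · rintro ⟨a, b⟩ hx ⟨c, d⟩ hy hxy
    rw [Function.onFun, Finset.disjoint_left]
    intro p hp hp'
    simp only [Finset.mem_image] at hp hp'
    obtain ⟨_, _, rfl⟩ := hp
    obtain ⟨_, _, hq⟩ := hp'
    simp only [List.cons.injEq, KStep.horiz.injEq] at hq
    apply hxy
    simp only [Finset.mem_coe, Finset.HasAntidiagonal.mem_antidiagonal] at hx hy
    ext <;> simp <;> omega
  · rw [Finset.disjoint_left]
    intro p hp hp'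
    simp only [Finset.mem_image] at hp hp'
    obtain ⟨_, _, rfl⟩ := hp
    obtain ⟨_, _, hq⟩ := hp'
    simp at hq
  · rw [Finset.disjoint_left]
    intro p hp hp'
    simp only [Finset.mem_image, Finset.mem_union, Finset.mem_biUnion] at hp hp'
    obtain ⟨_, _, _, _, rfl⟩ := hp'
    rcases hp with ⟨_, _, hq⟩ | ⟨_, _, hq⟩ <;> simp at hq

/-- Generating function of paths started at height `h`. -/
noncomputable def KT (k : ℕ) (h : ℤ) : PowerSeries ℤ := PowerSeries.mk fun n => (KA k h n : ℤ)

/-- Generating function of the `k`-Fibonacci numbers. -/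
noncomputable def KF (k : ℕ) : PowerSeries ℤ := PowerSeries.mk fun n => (kFib k n : ℤ)

lemma KT_neg {k h} (hh : h < 0) : KT k h = 0 := by
  ext n
  simp [KT, KA_neg hh]

lemma KT_rec {k h} (hh : 0 ≤ h) : KT k h = (if h = 0 then 1 else 0) +
    PowerSeries.X * KT k (h+1) + PowerSeries.X * KT k (h-1) + KF k * KT k h := by
  ext n
  rcases n with _ | n
  · have : PowerSeries.constantCoeff (KF k) = 0 := by
      rw [← PowerSeries.coeff_zero_eq_constantCoeff_apply]; simp [KF, kFib]
    have h2 : PowerSeries.constantCoeff (KT k h) = if h = 0 then 1 else 0 := by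
      rw [← PowerSeries.coeff_zero_eq_constantCoeff_apply]; simp [KT, KA_zero]
    simp [this, h2]
  · have h1 : PowerSeries.coeff (n+1) (if h = 0 then (1 : PowerSeries ℤ) else 0) = 0 := by
      split_ifs <;> simp [PowerSeries.coeff_one]
    simp only [map_add, h1, PowerSeries.coeff_succ_X_mul]
    rw [PowerSeries.coeff_mul]
    simp only [KT, KF, PowerSeries.coeff_mk, KA_succ hh]
    push_cast
    ring

lemma KF_eq (k : ℕ) :
    (1 - (k : PowerSeries ℤ) * PowerSeries.X - PowerSeries.X ^ 2) * KF k = PowerSeries.X := by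
  have : KF k = PowerSeries.X + (k : PowerSeries ℤ) * (PowerSeries.X * KF k)
      + PowerSeries.X * (PowerSeries.X * KF k) := by
    ext n
    have hc : (k : PowerSeries ℤ) = PowerSeries.C (k : ℤ) := by simp
    rw [hc]
    simp only [map_add, PowerSeries.coeff_C_mul]
    rcases n with _ | _ | n
    · simp [KF, kFib]
    · rw [PowerSeries.coeff_succ_X_mul, PowerSeries.coeff_succ_X_mul]
      simp [KF, kFib]
    · rw [PowerSeries.coeff_succ_X_mul, PowerSeries.coeff_succ_X_mul, PowerSeries.coeff_succ_X_mul]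
      simp [KF, kFib, PowerSeries.coeff_X]
  linear_combination this

lemma KF_dvd (k : ℕ) : PowerSeries.X ∣ KF k := by
  rw [PowerSeries.X_dvd_iff, ← PowerSeries.coeff_zero_eq_constantCoeff_apply]
  simp [KF, kFib]

lemma KT_one (k : ℕ) : KT k 1 = PowerSeries.X * KT k 0 * KT k 0 := by
  let D : ℤ → PowerSeries ℤ := fun h => KT k (h+1) - PowerSeries.X * KT k 0 * KT k h
  have hD : ∀ h, 0 ≤ h → D h = PowerSeries.X * D (h+1) +
      PowerSeries.X * (if h = 0 then 0 else D (h-1)) + KF k * D h := by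
    intro h hh
    have e1 := KT_rec (k := k) (h := h+1) (by omega)
    have e2 := KT_rec (k := k) (h := h) hh
    rw [if_neg (by omega)] at e1
    simp only [add_sub_cancel_right] at e1
    by_cases h0 : h = 0
    · subst h0
      simp only [if_true, D] at e2 ⊢
      rw [KT_neg (h := 0 - 1) (by norm_num)] at e2
      linear_combination e1 - PowerSeries.X * KT k 0 * e2
    · simp only [if_neg h0, D, sub_add_cancel] at e2 ⊢
      linear_combination e1 - PowerSeries.X * KT k 0 * e2
  obtain ⟨G, hG⟩ := KF_dvd k
  have hdvd : ∀ n : ℕ, ∀ h, 0 ≤ h → PowerSeries.X ^ n ∣ D h := by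
    intro n
    induction n with
    | zero => intro h _; simp
    | succ n ih =>
      intro h hh
      rw [hD h hh, hG, pow_succ', mul_assoc]
      refine dvd_add (dvd_add (mul_dvd_mul_left _ (ih _ (by omega))) (mul_dvd_mul_left _ ?_))
        (mul_dvd_mul_left _ ((ih _ hh).mul_left _))
      split_ifs with h0
      · exact dvd_zero _
      · exact ih _ (by omega)
  have : D 0 = 0 := by
    ext n
    exact PowerSeries.X_pow_dvd_iff.1 (hdvd (n+1) 0 le_rfl) n (by omega)
  simp only [D, zero_add] at this
  exact sub_eq_zero.1 this

/-- Fix a positive integer `k`. For each `n` the set of `k`-Fibonacci paths of length `n`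
is finite, and the generating function `T = ∑_{n≥0} |M_{F_{k,n}}| z^n ∈ ℤ⟦z⟧` satisfies
`z²·(1−kz−z²)·T² − (1−(k+1)z−z²)·T + (1−kz−z²) = 0`. -/
theorem kFibPath_gf_quadratic (k : ℕ) (hk : 0 < k) :
    (∀ n, (KFibPath k n).Finite) ∧
    (let T : PowerSeries ℤ := PowerSeries.mk fun n => ((KFibPath k n).ncard : ℤ)
     PowerSeries.X ^ 2 * (1 - (k : PowerSeries ℤ) * PowerSeries.X - PowerSeries.X ^ 2) * T ^ 2
       - (1 - ((k : PowerSeries ℤ) + 1) * PowerSeries.X - PowerSeries.X ^ 2) * T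
       + (1 - (k : PowerSeries ℤ) * PowerSeries.X - PowerSeries.X ^ 2) = 0) := by
  have hS : ∀ n, KFibPath k n = KS k 0 n := by
    intro n
    simp [KFibPath, KS]
  refine ⟨fun n => hS n ▸ KS_finite k n 0, ?_⟩
  intro T
  have hT : T = KT k 0 := by
    ext n
    simp only [T, KT, PowerSeries.coeff_mk, hS, KA]
    rw [Set.ncard_eq_toFinset_card _ (KS_finite k n 0)]
  rw [hT]
  have e := KT_rec (k := k) (h := 0) le_rfl
  rw [KT_neg (h := 0 - 1) (by norm_num), if_pos rfl, zero_add, KT_one] at e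
  have f := KF_eq k
  linear_combination (-(1 - (k : PowerSeries ℤ) * PowerSeries.X - PowerSeries.X ^ 2)) * e
    - KT k 0 * f
end

section
/- Fix a positive integer k and a natural number t. The number of k-Fibonacci paths of length t equals |M_{F_{k,t}}| = ∑_{n=0}^{⌊t/2⌋} ∑_{m=0}^{t−2n} C(m+2n, m) · C_n · F_{k, t−2n−m+1}^{(m)}, where C_n is the n-th Catalan number, C(a,b) a binomial coefficient, and F_{k,j}^{(m)} a convolved k-Fibonacci number. -/
open Classical in
/-- all valid steps of width at most `w` -/
noncomputable def stepsF (k w : ℕ) : Finset KStep :=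
  (if 1 ≤ w then {KStep.up, KStep.down} else ∅) ∪
    (Finset.range (w + 1)).biUnion
      (fun l => (Finset.Icc 1 (kFib k l)).image (fun c => KStep.horiz l c))

lemma mem_stepsF (k w : ℕ) (s : KStep) :
    s ∈ stepsF k w ↔ s.Valid k ∧ s.width ≤ w := by
  classical
  unfold stepsF
  rcases s with _ | _ | ⟨l, c⟩
  · by_cases h : 1 ≤ w <;> simp [h, KStep.Valid, KStep.width]
  · by_cases h : 1 ≤ w <;> simp [h, KStep.Valid, KStep.width]
  · by_cases h : 1 ≤ w
    · simp [h, KStep.Valid, KStep.width]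
      rcases l with _ | l
      · simp [kFib]; intros; omega
      · constructor <;> intro hh <;> refine ⟨?_, ?_⟩ <;> omega
    · obtain rfl : w = 0 := by omega
      simp [KStep.Valid, KStep.width]
      constructor
      · rintro ⟨⟨h1, h2⟩, rfl⟩; simp [kFib] at h2; omega
      · omega

lemma sum_stepsF (k w : ℕ) (f : KStep → ℤ) :
    ∑ s ∈ stepsF k w, f s = (if 1 ≤ w then f .up + f .down else 0) +
      ∑ l ∈ Finset.range (w + 1), ∑ c ∈ Finset.Icc 1 (kFib k l), f (.horiz l c) := by
  classical
  unfold stepsF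
  rw [Finset.sum_union, Finset.sum_biUnion]
  · congr 1
    · split_ifs
      · rw [Finset.sum_pair (by simp)]
      · simp
    · refine Finset.sum_congr rfl fun l _ => ?_
      rw [Finset.sum_image]
      intro a _ b _ h
      simpa using h
  · intro a _ b _ hab
    simp only [Function.onFun]
    rw [Finset.disjoint_left]
    intro s hs hs'
    simp only [Finset.mem_image] at hs hs'
    obtain ⟨c, _, rfl⟩ := hs
    obtain ⟨c', _, h⟩ := hs'
    injection h with h1 h2
    exact hab h1.symm
  · rw [Finset.disjoint_left]
    intro s hs hs'
    simp only [Finset.mem_biUnion, Finset.mem_image] at hs'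
    obtain ⟨l, _, c, _, rfl⟩ := hs'
    split_ifs at hs <;> simp at hs

open Classical in
/-- paths with `L` steps, starting at height `h`, ending at height `0`, of width `w` -/
noncomputable def pathsF (k : ℕ) : ℕ → ℤ → ℕ → Finset (List KStep)
  | 0, h, w => if h = 0 ∧ w = 0 then {[]} else ∅
  | L + 1, h, w => if h < 0 then ∅ else
      (stepsF k w).biUnion (fun s => (pathsF k L (h + s.ht) (w - s.width)).image (List.cons s))

lemma mem_pathsF (k : ℕ) (L : ℕ) : ∀ (h : ℤ) (w : ℕ) (p : List KStep),
    p ∈ pathsF k L h w ↔ p.length = L ∧ (∀ s ∈ p, s.Valid k) ∧ pathWidth p = w ∧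
      (∀ q, q <+: p → 0 ≤ h + pathHt q) ∧ h + pathHt p = 0 := by
  classical
  induction L with
  | zero =>
    intro h w p
    simp only [pathsF]
    constructor
    · intro hp
      split_ifs at hp with hh
      · simp only [Finset.mem_singleton] at hp
        subst hp
        obtain ⟨rfl, rfl⟩ := hh
        simp [pathWidth, pathHt]
      · simp at hp
    · rintro ⟨h1, -, h3, -, h5⟩
      obtain rfl := List.length_eq_zero_iff.mp h1
      simp [pathWidth, pathHt] at h3 h5
      simp [h5, ← h3]
  | succ L ih =>
    intro h w p
    simp only [pathsF]
    by_cases hh : h < 0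
    · rw [if_pos hh]
      simp only [Finset.notMem_empty, false_iff]
      rintro ⟨-, -, -, h4, -⟩
      have := h4 [] (List.nil_prefix)
      simp [pathHt] at this
      omega
    · rw [if_neg hh]
      rcases p with _ | ⟨s, p⟩
      · simp
      · have key : (s :: p ∈ (stepsF k w).biUnion
            (fun s => (pathsF k L (h + s.ht) (w - s.width)).image (List.cons s))) ↔
            s ∈ stepsF k w ∧ p ∈ pathsF k L (h + s.ht) (w - s.width) := by
          simp only [Finset.mem_biUnion, Finset.mem_image, List.cons.injEq]
          constructor
          · rintro ⟨a, ha, b, hb, rfl, rfl⟩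
            exact ⟨ha, hb⟩
          · rintro ⟨ha, hb⟩
            exact ⟨s, ha, p, hb, rfl, rfl⟩
        rw [key, ih, mem_stepsF]
        have e1 : pathWidth (s :: p) = s.width + pathWidth p := by simp [pathWidth]
        have e2 : ∀ q, pathHt (s :: q) = s.ht + pathHt q := by simp [pathHt]
        rw [e1, e2]
        constructor
        · rintro ⟨⟨v, w1⟩, rfl, v', w2, pr, fin⟩
          refine ⟨by simp, by simpa using ⟨v, v'⟩, by omega, ?_, by omega⟩
          intro q hq
          rcases q with _ | ⟨a, q⟩
          · simp [pathHt]; omega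
          · rw [List.cons_prefix_cons] at hq
            obtain ⟨rfl, hq⟩ := hq
            rw [e2, ← add_assoc]
            exact pr q hq
        · rintro ⟨l, v, w1, pr, fin⟩
          simp only [List.mem_cons, forall_eq_or_imp] at v
          refine ⟨⟨v.1, by omega⟩, by simpa using l, v.2, by omega, ?_, by omega⟩
          intro q hq
          have := pr (s :: q) (by rw [List.cons_prefix_cons]; exact ⟨rfl, hq⟩)
          rw [e2] at this
          omega

lemma card_pathsF_succ (k L : ℕ) (h : ℤ) (w : ℕ) : ((pathsF k (L + 1) h w).card : ℤ) =
    if h < 0 then 0 else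
      ∑ s ∈ stepsF k w, ((pathsF k L (h + s.ht) (w - s.width)).card : ℤ) := by
  classical
  rw [pathsF]
  split_ifs with hh
  · simp
  · rw [Finset.card_biUnion]
    · push_cast
      refine Finset.sum_congr rfl fun s _ => ?_
      rw [Finset.card_image_of_injective]
      exact List.cons_injective
    · intro a _ b _ hab
      simp only [Function.onFun]
      rw [Finset.disjoint_left]
      intro p hp hp'
      simp only [Finset.mem_image] at hp hp'
      obtain ⟨c, _, rfl⟩ := hp
      obtain ⟨c', _, h⟩ := hp'
      injection h with h1 h2
      exact hab h1.symm

open PowerSeries in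
/-- generating function of the paths with `L` steps starting at height `h` -/
noncomputable def genF (k L : ℕ) (h : ℤ) : PowerSeries ℤ :=
  PowerSeries.mk fun w => ((pathsF k L h w).card : ℤ)

/-- generating function of the horizontal steps -/
noncomputable def horF (k : ℕ) : PowerSeries ℤ := PowerSeries.mk fun l => (kFib k l : ℤ)

lemma genF_zero (k : ℕ) (h : ℤ) : genF k 0 h = if h = 0 then 1 else 0 := by
  classical
  ext w
  by_cases hh : h = 0 <;> by_cases hw : w = 0 <;>
    simp [genF, pathsF, hh, hw, PowerSeries.coeff_one]

lemma genF_succ (k L : ℕ) (h : ℤ) : genF k (L + 1) h = if h < 0 then 0 else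
    PowerSeries.X * (genF k L (h + 1) + genF k L (h - 1)) + horF k * genF k L h := by
  ext w
  rw [genF, PowerSeries.coeff_mk, card_pathsF_succ]
  split_ifs with hh
  · simp
  · rw [sum_stepsF, map_add]
    congr 1
    · rcases w with _ | w
      · simp
      · simp [PowerSeries.coeff_succ_X_mul, genF, KStep.ht, KStep.width, sub_eq_add_neg]
    · rw [PowerSeries.coeff_mul, Finset.Nat.sum_antidiagonal_eq_sum_range_succ_mk]
      refine Finset.sum_congr rfl fun l _ => ?_
      simp [genF, horF, KStep.ht, KStep.width]

/-- number of nonnegative `±1` paths with `j` steps from height `h` to `0` -/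
def bal : ℕ → ℤ → ℤ
  | 0, h => if h = 0 then 1 else 0
  | j + 1, h => if h < 0 then 0 else bal j (h + 1) + bal j (h - 1)

lemma bal_neg (j : ℕ) (h : ℤ) (hh : h < 0) : bal j h = 0 := by
  rcases j with _ | j
  · simp [bal]; omega
  · simp [bal, hh]

lemma bal_eq (j : ℕ) : ∀ h : ℕ, 
    (∀ n, j = h + 2 * n → bal j h = (j.choose n : ℤ) - j.choose (n + h + 1)) ∧
    ((∀ n, j ≠ h + 2 * n) → bal j h = 0) := by
  induction j with
  | zero =>
    intro h
    refine ⟨fun n hn => ?_, fun hn => ?_⟩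
    · obtain rfl : h = 0 := by omega
      obtain rfl : n = 0 := by omega
      simp [bal]
    · have := hn 0
      simp [bal]; omega
  | succ j ih =>
    intro h
    have e : bal (j + 1) h = bal j ((h + 1 : ℕ) : ℤ) + bal j ((h : ℤ) - 1) := by
      simp [bal]
    rw [e]
    rcases h with _ | h
    · rw [bal_neg j (((0 : ℕ) : ℤ) - 1) (by simp), add_zero]
      refine ⟨fun n hn => ?_, fun hn => ?_⟩
      · obtain ⟨n, rfl⟩ : ∃ m, n = m + 1 := ⟨n - 1, by omega⟩
        rw [(ih 1).1 n (by omega)]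
        simp only [Nat.choose_succ_succ, add_zero]
        push_cast
        ring
      · refine (ih 1).2 fun n h => hn (n + 1) (by omega)
    · have e' : (((h + 1 : ℕ) : ℤ) - 1) = (h : ℕ) := by push_cast; ring
      rw [e']
      refine ⟨fun n hn => ?_, fun hn => ?_⟩
      · rw [(ih h).1 n (by omega)]
        rcases n with _ | n
        · rw [(ih (h + 1 + 1)).2 (by omega)]
          rw [Nat.choose_eq_zero_of_lt (show j < 0 + h + 1 by omega),
            Nat.choose_eq_zero_of_lt (show j + 1 < 0 + (h + 1) + 1 by omega)]
          simp
        · rw [(ih (h + 1 + 1)).1 n (by omega)]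
          have e3 : n + 1 + (h + 1) + 1 = (n + h + 2) + 1 := by ring
          have e4 : n + (h + 1 + 1) + 1 = (n + h + 2) + 1 := by ring
          have e5 : n + 1 + h + 1 = n + h + 2 := by ring
          rw [e3, e4, e5, Nat.choose_succ_succ j n, Nat.choose_succ_succ j (n + h + 2)]
          push_cast
          ring
      · rw [(ih h).2 fun n h => hn n (by omega),
          (ih (h + 1 + 1)).2 fun n h => hn (n + 1) (by omega)]
        simp

lemma bal_odd (j : ℕ) (hj : ∀ n, j ≠ 2 * n) : bal j 0 = 0 := by
  have := (bal_eq j 0).2 (by simpa using hj)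
  simpa using this

lemma bal_even (n : ℕ) : bal (2 * n) 0 = catalan n := by
  have h1 := (bal_eq (2 * n) 0).1 n (by simp)
  have h2 := succ_mul_catalan_eq_centralBinom n
  have h3 := Nat.choose_succ_right_eq (2 * n) n
  rw [Nat.centralBinom] at h2
  rw [show 2 * n - n = n by omega] at h3
  simp only [Nat.cast_zero, add_zero] at h1
  rw [h1]
  zify at h2 h3
  have : ((n : ℤ) + 1) ≠ 0 := by positivity
  apply mul_left_cancel₀ this
  linear_combination -h3 - h2

lemma genF_eq (k L : ℕ) : ∀ h : ℤ, genF k L h =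
    ∑ ij ∈ Finset.HasAntidiagonal.antidiagonal L, (L.choose ij.1 : PowerSeries ℤ) *
      ((bal ij.1 h : PowerSeries ℤ) * PowerSeries.X ^ ij.1 * horF k ^ ij.2) := by
  induction L with
  | zero =>
    intro h
    rw [genF_zero]
    simp [bal]
  | succ L ih =>
    intro h
    rw [genF_succ]
    split_ifs with hh
    · symm
      refine Finset.sum_eq_zero fun ij _ => ?_
      simp [bal_neg _ _ hh]
    · rw [Finset.sum_antidiagonal_choose_succ_mul
        (fun i j => (bal i h : PowerSeries ℤ) * PowerSeries.X ^ i * horF k ^ j), ih, ih, ih,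
        add_comm]
      rw [← Finset.sum_add_distrib, Finset.mul_sum, Finset.mul_sum]
      congr 1
      · refine Finset.sum_congr rfl fun ij _ => ?_
        ring
      · refine Finset.sum_congr rfl fun ij hij => ?_
        rw [Finset.HasAntidiagonal.mem_antidiagonal] at hij
        have : L.choose ij.2 = L.choose ij.1 := by
          rw [← hij]; exact (Nat.choose_symm_add).symm
        rw [this]
        simp only [bal, if_neg hh]
        push_cast
        ring

lemma horF_mul (k : ℕ) :
    (1 - (k : PowerSeries ℤ) * PowerSeries.X - PowerSeries.X ^ 2) * horF k = PowerSeries.X := by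
  have e : (1 - (k : PowerSeries ℤ) * PowerSeries.X - PowerSeries.X ^ 2) * horF k =
    horF k - PowerSeries.X * (PowerSeries.C (k : ℤ) * horF k + PowerSeries.X * horF k) := by
    simp; ring
  rw [e]
  ext n
  rcases n with _ | _ | n
  · simp [horF, kFib]
  · simp [horF, kFib, PowerSeries.coeff_succ_X_mul]
  · rw [map_sub, PowerSeries.coeff_succ_X_mul, map_add, PowerSeries.coeff_succ_X_mul,
      PowerSeries.coeff_C_mul]
    simp [horF, kFib, PowerSeries.coeff_X]

lemma pathWidth_ge (k : ℕ) (p : List KStep) (hp : ∀ s ∈ p, s.Valid k) :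
    p.length ≤ pathWidth p := by
  induction p with
  | nil => simp
  | cons s p ih =>
    simp only [List.mem_cons, forall_eq_or_imp] at hp
    have h1 := ih hp.2
    have h2 : 1 ≤ s.width := by
      rcases s with _ | _ | ⟨l, c⟩
      · simp [KStep.width]
      · simp [KStep.width]
      · exact hp.1.1
    simp [pathWidth] at h1 ⊢
    omega

lemma sum_even (f : ℕ → ℤ) (t : ℕ) (hf : ∀ j, (∀ n, j ≠ 2 * n) → f j = 0) :
    ∑ i ∈ Finset.range (t + 1), f i = ∑ n ∈ Finset.range (t / 2 + 1), f (2 * n) := by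
  classical
  rw [← Finset.sum_image (s := Finset.range (t / 2 + 1)) (g := fun n => 2 * n) (f := f)
    (by intro a _ b _ h; simpa using h)]
  symm
  apply Finset.sum_subset
  · intro i hi
    simp only [Finset.mem_image, Finset.mem_range] at hi ⊢
    omega
  · intro i hi hi'
    apply hf
    rintro n rfl
    apply hi'
    simp only [Finset.mem_image, Finset.mem_range] at hi ⊢
    exact ⟨n, by omega, rfl⟩

lemma sum_tri (g : ℕ → ℕ → ℤ) (t : ℕ) :
    ∑ L ∈ Finset.range (t + 1), ∑ ij ∈ Finset.HasAntidiagonal.antidiagonal L, g ij.1 ij.2 =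
      ∑ i ∈ Finset.range (t + 1), ∑ m ∈ Finset.range (t - i + 1), g i m := by
  rw [Finset.sum_sigma', Finset.sum_sigma']
  refine Finset.sum_bij' (fun x _ => ⟨x.2.1, x.2.2⟩) (fun y _ => ⟨y.1 + y.2, (y.1, y.2)⟩)
    ?_ ?_ ?_ ?_ ?_
  · rintro ⟨L, i, j⟩ h
    simp only [Finset.mem_sigma, Finset.mem_range, Finset.HasAntidiagonal.mem_antidiagonal] at h ⊢
    omega
  · rintro ⟨i, j⟩ h
    simp only [Finset.mem_sigma, Finset.mem_range, Finset.HasAntidiagonal.mem_antidiagonal] at h ⊢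
    exact ⟨by omega, trivial⟩
  · rintro ⟨L, i, j⟩ h
    simp only [Finset.mem_sigma, Finset.mem_range, Finset.HasAntidiagonal.mem_antidiagonal] at h
    obtain ⟨_, rfl⟩ := h
    rfl
  · rintro ⟨i, j⟩ h
    rfl
  · rintro ⟨L, i, j⟩ h
    rfl

/-- Fix a positive integer `k` and a natural number `t`. The number of `k`-Fibonacci
paths of length `t` equals
`∑_{n=0}^{⌊t/2⌋} ∑_{m=0}^{t−2n} C(m+2n, m) · C_n · F_{k, t−2n−m+1}^{(m)}`,
where `C_n` is the `n`-th Catalan number and `F r j = F_{k,j+1}^{(r)}` is the family of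
convolved `k`-Fibonacci numbers, characterized by
`(1 - kx - x²)^r · ∑_j F_{k,j+1}^{(r)} x^j = 1` in `ℤ⟦x⟧`. -/
theorem kFibPath_card_eq (k : ℕ) (hk : 0 < k) (t : ℕ) (F : ℕ → ℕ → ℤ)
    (hF : ∀ r : ℕ,
      (1 - (k : PowerSeries ℤ) * PowerSeries.X - PowerSeries.X ^ 2) ^ r *
        PowerSeries.mk (F r) = 1) :
    (KFibPath k t).Finite ∧
    ((KFibPath k t).ncard : ℤ) =
      ∑ n ∈ Finset.range (t / 2 + 1), ∑ m ∈ Finset.range (t - 2 * n + 1),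
        ((m + 2 * n).choose m : ℤ) * (catalan n : ℤ) * F m (t - 2 * n - m) := by
  classical
  have hset : KFibPath k t =
      ↑((Finset.range (t + 1)).biUnion (fun L => pathsF k L 0 t)) := by
    ext p
    simp only [KFibPath, Set.mem_ofPred_eq, Finset.coe_biUnion, Set.mem_iUnion, Finset.mem_coe,
      mem_pathsF, zero_add, Finset.mem_range, exists_prop]
    constructor
    · rintro ⟨h1, h2, h3, h4⟩
      have := pathWidth_ge k p h1
      exact ⟨p.length, by omega, rfl, h1, h2, h3, h4⟩
    · rintro ⟨L, -, -, h⟩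
      exact h
  rw [hset]
  refine ⟨Finset.finite_toSet _, ?_⟩
  rw [Set.ncard_coe_finset, Finset.card_biUnion]
  swap
  · intro a _ b _ hab
    simp only [Function.onFun]
    rw [Finset.disjoint_left]
    intro p hp hp'
    rw [mem_pathsF] at hp hp'
    exact hab (hp.1.symm.trans hp'.1)
  have hpow : ∀ m, horF k ^ m = PowerSeries.X ^ m * PowerSeries.mk (F m) := by
    intro m
    rw [← horF_mul k, mul_pow]
    linear_combination (-(horF k ^ m)) * hF m
  have hL : ∀ L ∈ Finset.range (t + 1), ((pathsF k L 0 t).card : ℤ) =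
      ∑ ij ∈ Finset.HasAntidiagonal.antidiagonal L,
        ((ij.2 + ij.1).choose ij.2 : ℤ) * bal ij.1 0 * F ij.2 (t - ij.1 - ij.2) := by
    intro L hLt
    have h1 : ((pathsF k L 0 t).card : ℤ) = PowerSeries.coeff t (genF k L 0) := by
      simp [genF]
    rw [h1, genF_eq, map_sum]
    refine Finset.sum_congr rfl fun ij hij => ?_
    rw [Finset.HasAntidiagonal.mem_antidiagonal] at hij
    rw [Finset.mem_range] at hLt
    have h2 : (L.choose ij.1 : PowerSeries ℤ) *
      ((bal ij.1 0 : PowerSeries ℤ) * PowerSeries.X ^ ij.1 * horF k ^ ij.2) =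
      PowerSeries.C ((L.choose ij.1 : ℤ) * bal ij.1 0) *
        (PowerSeries.X ^ (ij.1 + ij.2) * PowerSeries.mk (F ij.2)) := by
      rw [hpow]
      simp
      ring
    rw [h2, PowerSeries.coeff_C_mul, PowerSeries.coeff_X_pow_mul', if_pos (by omega),
      PowerSeries.coeff_mk, ← hij, Nat.choose_symm_add, add_comm ij.2 ij.1, Nat.sub_sub]
  push_cast
  rw [Finset.sum_congr rfl hL,
    sum_tri (fun i m => ((m + i).choose m : ℤ) * bal i 0 * F m (t - i - m)) t, sum_even]
  · simp only [bal_even]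
  · intro j hj
    simp [bal_odd j hj]
end

section
/- Fix a positive integer k. For each n, the set of grand k-Fibonacci paths of length n is finite; let b_n = |M*_{F_{k,n}}| be its cardinality and let T* = ∑_{n≥0} b_n z^n ∈ ℤ⟦z⟧. Then T* satisfies ((1−(k+1)z−z^2)^2 − 4z^2·(1−kz−z^2)^2) · (T*)^2 = (1−kz−z^2)^2. -/
/-- Valid paths of width `n` ending at height `h`. -/
def PathsTo (k n : ℕ) (h : ℤ) : Set (List KStep) :=
  {p | (∀ s ∈ p, s.Valid k) ∧ pathWidth p = n ∧ pathHt p = h}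

theorem pathWidth_cons (s : KStep) (p : List KStep) :
    pathWidth (s :: p) = s.width + pathWidth p := by simp [pathWidth]

theorem pathHt_cons (s : KStep) (p : List KStep) :
    pathHt (s :: p) = s.ht + pathHt p := by simp [pathHt]

theorem pathHt_le_width (p : List KStep) : pathHt p ≤ pathWidth p := by
  induction p with
  | nil => simp [pathHt, pathWidth]
  | cons s p ih =>
    rw [pathWidth_cons, pathHt_cons]
    cases s <;> simp [KStep.ht, KStep.width] <;> omega

theorem width_pos {k : ℕ} {s : KStep} (h : s.Valid k) : 1 ≤ s.width := by
  cases s <;> simp_all [KStep.Valid, KStep.width]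

theorem pathsTo_zero (k : ℕ) (h : ℤ) : PathsTo k 0 h = if h = 0 then {[]} else ∅ := by
  ext p
  cases p with
  | nil => by_cases hh : h = 0 <;> simp [PathsTo, pathWidth, pathHt, hh, eq_comm]
  | cons s p =>
    have : (s :: p) ∉ PathsTo k 0 h := by
      rintro ⟨h1, h2, -⟩
      have := width_pos (h1 s (by simp))
      rw [pathWidth_cons] at h2
      omega
    by_cases hh : h = 0 <;> simp [this, hh]
    subst hh; exact this

/-- The index set of coloured horizontal first steps. -/
def horizIdx (k n : ℕ) : Finset (Σ _ : ℕ × ℕ, ℕ) :=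
  (Finset.HasAntidiagonal.antidiagonal n).sigma fun ij => Finset.Icc 1 (kFib k ij.1)

theorem mem_pathsTo_cons (k n : ℕ) (h : ℤ) (s : KStep) (p : List KStep) :
    s :: p ∈ PathsTo k n h ↔ s.Valid k ∧ s.width ≤ n ∧ p ∈ PathsTo k (n - s.width) (h - s.ht) := by
  simp only [PathsTo, Set.mem_ofPred_eq, List.forall_mem_cons, pathWidth_cons, pathHt_cons]
  constructor
  · rintro ⟨⟨a, b⟩, c, d⟩
    exact ⟨a, by omega, b, by omega, by omega⟩
  · rintro ⟨a, c, b, d, e⟩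
    exact ⟨⟨a, b⟩, by omega, by omega⟩

theorem pathsTo_succ (k n : ℕ) (h : ℤ) :
    PathsTo k (n + 1) h = (List.cons KStep.up '' PathsTo k n (h - 1) ∪
      List.cons KStep.down '' PathsTo k n (h + 1)) ∪
      ⋃ x ∈ horizIdx k (n + 1), List.cons (KStep.horiz x.1.1 x.2) '' PathsTo k x.1.2 h := by
  ext p
  cases p with
  | nil => simp [PathsTo, pathWidth]
  | cons s p =>
    rw [mem_pathsTo_cons]
    cases s with
    | up => simp [KStep.Valid, KStep.width, KStep.ht]
    | down => simp [KStep.Valid, KStep.width, KStep.ht]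
    | horiz l c =>
      simp only [KStep.Valid, KStep.width, KStep.ht, Set.mem_union, Set.mem_image, Set.mem_iUnion,
        horizIdx, Finset.mem_sigma, Finset.HasAntidiagonal.mem_antidiagonal, Finset.mem_Icc, List.cons.injEq,
        KStep.horiz.injEq, sub_zero]
      constructor
      · rintro ⟨⟨a, b, c'⟩, d, e⟩
        exact Or.inr ⟨⟨(l, n + 1 - l), c⟩, ⟨by simp; omega, b, c'⟩, p, e, ⟨rfl, rfl⟩, rfl⟩
      · rintro ((⟨_, _, h, _⟩ | ⟨_, _, h, _⟩) | ⟨⟨⟨i, j⟩, c'⟩, ⟨h1, h2, h3⟩, q, h4, ⟨h5, h6⟩, h7⟩)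
        · cases h
        · cases h
        · simp only at h1 h2 h3 h4 h5 h6
          subst h5 h6 h7
          have hi : 1 ≤ i := by
            rcases Nat.eq_zero_or_pos i with rfl | hi
            · simp [kFib] at h3; omega
            · exact hi
          refine ⟨⟨hi, h2, h3⟩, by omega, ?_⟩
          have : n + 1 - i = j := by omega
          rwa [this]

theorem idx_snd_le {k n : ℕ} {x : Σ _ : ℕ × ℕ, ℕ} (hx : x ∈ horizIdx k (n + 1)) : x.1.2 ≤ n := by
  obtain ⟨⟨i, j⟩, c⟩ := x
  simp only [horizIdx, Finset.mem_sigma, Finset.HasAntidiagonal.mem_antidiagonal, Finset.mem_Icc] at hx ⊢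
  rcases Nat.eq_zero_or_pos i with rfl | hi
  · simp [kFib] at hx; omega
  · omega

theorem pathsTo_finite (k n : ℕ) : ∀ h, (PathsTo k n h).Finite := by
  induction n using Nat.strong_induction_on with
  | _ n ih =>
    intro h
    cases n with
    | zero => rw [pathsTo_zero]; split_ifs <;> simp
    | succ n =>
      rw [pathsTo_succ]
      refine ((((ih n (by omega) _).image _).union ((ih n (by omega) _).image _))).union ?_
      refine Set.Finite.biUnion (Finset.finite_toSet _) fun x hx => ?_
      exact (ih _ (by have := idx_snd_le hx; omega) _).image _

theorem ncard_pathsTo_succ (k n : ℕ) (h : ℤ) :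
    (PathsTo k (n + 1) h).ncard = (PathsTo k n (h - 1)).ncard + (PathsTo k n (h + 1)).ncard +
      ∑ ij ∈ Finset.HasAntidiagonal.antidiagonal (n + 1), kFib k ij.1 * (PathsTo k ij.2 h).ncard := by
  classical
  have inj : ∀ s : KStep, Function.Injective (List.cons s) := fun s => List.cons_injective
  have fin3 : (⋃ x ∈ horizIdx k (n + 1),
      List.cons (KStep.horiz x.1.1 x.2) '' PathsTo k x.1.2 h).Finite :=
    Set.Finite.biUnion (Finset.finite_toSet _) fun x hx => (pathsTo_finite k _ _).image _
  have h3 : (⋃ x ∈ horizIdx k (n + 1),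
      List.cons (KStep.horiz x.1.1 x.2) '' PathsTo k x.1.2 h).ncard =
      ∑ ij ∈ Finset.HasAntidiagonal.antidiagonal (n + 1), kFib k ij.1 * (PathsTo k ij.2 h).ncard := by
    have e : (⋃ x ∈ horizIdx k (n + 1),
        List.cons (KStep.horiz x.1.1 x.2) '' PathsTo k x.1.2 h) =
        (((horizIdx k (n + 1)).biUnion fun x =>
          (pathsTo_finite k x.1.2 h).toFinset.image (List.cons (KStep.horiz x.1.1 x.2)) :
          Finset (List KStep)) : Set (List KStep)) := by
      simp
    rw [e, Set.ncard_coe_finset, Finset.card_biUnion]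
    · rw [horizIdx, Finset.sum_sigma]
      refine Finset.sum_congr rfl fun ij _ => ?_
      rw [Set.ncard_eq_toFinset_card _ (pathsTo_finite k ij.2 h)]
      rw [Finset.sum_congr (g := fun _ => (pathsTo_finite k ij.2 h).toFinset.card) rfl
        (fun c _ => Finset.card_image_of_injective _ (inj _)), Finset.sum_const, Nat.card_Icc, smul_eq_mul, Nat.add_sub_cancel]
    · rintro ⟨⟨i, j⟩, c⟩ hx ⟨⟨i', j'⟩, c'⟩ hy hne
      rw [Function.onFun, Finset.disjoint_left]
      simp only [Finset.mem_image, not_exists, not_and]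
      rintro _ ⟨q, _, rfl⟩ q' _ heq
      simp only [List.cons.injEq, KStep.horiz.injEq] at heq
      simp only [horizIdx, Finset.mem_sigma, Finset.HasAntidiagonal.mem_antidiagonal, Finset.mem_coe] at hx hy
      obtain ⟨⟨rfl, rfl⟩, _⟩ := heq
      have : j = j' := by omega
      subst this
      exact hne rfl
  rw [pathsTo_succ, Set.ncard_union_eq _
      (((pathsTo_finite k _ _).image _).union ((pathsTo_finite k _ _).image _)) fin3,
    Set.ncard_union_eq _ ((pathsTo_finite k _ _).image _) ((pathsTo_finite k _ _).image _), h3,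
    Set.ncard_image_of_injective _ (inj _), Set.ncard_image_of_injective _ (inj _)]
  · rw [Set.disjoint_left]
    rintro _ ⟨q, _, rfl⟩ ⟨q', _, h⟩
    simp at h
  · rw [Set.disjoint_left]
    rintro _ (⟨q, _, rfl⟩ | ⟨q, _, rfl⟩) h <;> simp at h

/-- Reflection of a step. -/
def KStep.flip : KStep → KStep
  | .up => .down
  | .down => .up
  | .horiz l c => .horiz l c

theorem kstep_flip_flip (s : KStep) : s.flip.flip = s := by cases s <;> rfl

theorem flip_mem {k n : ℕ} {h : ℤ} {p : List KStep} (hp : p ∈ PathsTo k n h) :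
    p.map KStep.flip ∈ PathsTo k n (-h) := by
  obtain ⟨h1, rfl, rfl⟩ := hp
  refine ⟨?_, ?_, ?_⟩
  · intro s hs
    obtain ⟨t, ht, rfl⟩ := List.mem_map.1 hs
    have := h1 t ht
    cases t <;> exact this
  · clear h1
    induction p with
    | nil => rfl
    | cons s p ih =>
      rw [List.map_cons, pathWidth_cons, pathWidth_cons, ih]
      cases s <;> rfl
  · clear h1
    induction p with
    | nil => rfl
    | cons s p ih =>
      rw [List.map_cons, pathHt_cons, pathHt_cons, ih]
      cases s <;> simp [KStep.flip, KStep.ht] <;> ring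

theorem ncard_neg_le (k n : ℕ) (h : ℤ) : (PathsTo k n h).ncard ≤ (PathsTo k n (-h)).ncard := by
  refine Set.ncard_le_ncard_of_injOn (List.map KStep.flip) (fun p hp => flip_mem hp) ?_
    (pathsTo_finite k n _)
  refine Function.Injective.injOn (List.map_injective_iff.2 ?_)
  exact Function.LeftInverse.injective kstep_flip_flip

theorem ncard_neg (k n : ℕ) (h : ℤ) : (PathsTo k n (-h)).ncard = (PathsTo k n h).ncard := by
  refine le_antisymm ?_ (ncard_neg_le k n h)
  simpa using ncard_neg_le k n (-h)

open PowerSeries in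
/-- Generating function of the paths ending at height `h`. -/
noncomputable def gfTo (k : ℕ) (h : ℤ) : PowerSeries ℤ :=
  PowerSeries.mk fun n => ((PathsTo k n h).ncard : ℤ)

/-- Generating function of the `k`-Fibonacci numbers. -/
noncomputable def gfFib (k : ℕ) : PowerSeries ℤ := PowerSeries.mk fun n => (kFib k n : ℤ)

theorem gfFib_eq (k : ℕ) :
    (1 - (k : PowerSeries ℤ) * PowerSeries.X - PowerSeries.X ^ 2) * gfFib k = PowerSeries.X := by
  have e : (1 - (k : PowerSeries ℤ) * PowerSeries.X - PowerSeries.X ^ 2) * gfFib k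
      = gfFib k - PowerSeries.C (k : ℤ) * (PowerSeries.X * gfFib k)
        - PowerSeries.X * (PowerSeries.X * gfFib k) := by
    simp only [map_natCast]; ring
  rw [e]
  ext n
  rcases n with _ | _ | n
  · simp [gfFib, kFib]
  · simp only [map_sub, PowerSeries.coeff_C_mul, PowerSeries.coeff_succ_X_mul]
    simp [gfFib, kFib]
  · simp only [map_sub, PowerSeries.coeff_C_mul, PowerSeries.coeff_succ_X_mul]
    simp [gfFib, kFib, PowerSeries.coeff_X]

theorem gfTo_rec (k : ℕ) (h : ℤ) :
    gfTo k h = (if h = 0 then 1 else 0) + PowerSeries.X * (gfTo k (h - 1) + gfTo k (h + 1))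
      + gfFib k * gfTo k h := by
  ext n
  rcases n with _ | n
  · simp only [map_add, PowerSeries.coeff_mul]
    by_cases hh : h = 0 <;> simp [gfTo, gfFib, kFib, pathsTo_zero, hh]
  · have h0 : PowerSeries.coeff (n + 1) (if h = 0 then 1 else 0 : PowerSeries ℤ) = 0 := by
      split_ifs <;> simp [PowerSeries.coeff_one]
    simp only [map_add, PowerSeries.coeff_succ_X_mul, h0, PowerSeries.coeff_mul (n + 1) (gfFib k)]
    simp only [gfTo, gfFib, PowerSeries.coeff_mk, ncard_pathsTo_succ]
    push_cast
    ring

theorem X_pow_dvd_gfTo (k n : ℕ) : PowerSeries.X ^ n ∣ gfTo k n := by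
  rw [PowerSeries.X_pow_dvd_iff]
  intro m hm
  have : PathsTo k m n = ∅ := by
    ext p
    simp only [Set.mem_empty_iff_false, iff_false]
    rintro ⟨-, h1, h2⟩
    have := pathHt_le_width p
    omega
  simp [gfTo, this]

/-- The invariant of the three-term recurrence. -/
noncomputable def gfInv (k n : ℕ) : PowerSeries ℤ :=
  PowerSeries.X * gfTo k n ^ 2 - (1 - gfFib k) * gfTo k n * gfTo k (n + 1)
    + PowerSeries.X * gfTo k (n + 1) ^ 2

theorem gfInv_eq (k n : ℕ) : gfInv k n = gfInv k 0 := by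
  induction n with
  | zero => rfl
  | succ n ih =>
    rw [← ih]
    have r := gfTo_rec k ((n : ℤ) + 1)
    rw [if_neg (by omega), add_sub_cancel_right] at r
    simp only [gfInv]
    push_cast
    linear_combination (gfTo k n - gfTo k ((n : ℤ) + 1 + 1)) * r

theorem gfInv_zero (k : ℕ) : gfInv k 0 = 0 := by
  ext n
  have hd : PowerSeries.X ^ (n + 1) ∣ gfInv k 0 := by
    rw [← gfInv_eq k (n + 1)]
    have h1 := X_pow_dvd_gfTo k (n + 1)
    have h2 : PowerSeries.X ^ (n + 1) ∣ gfTo k (((n + 1 : ℕ) : ℤ) + 1) :=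
      (pow_dvd_pow _ (Nat.le_succ (n + 1))).trans (by exact_mod_cast X_pow_dvd_gfTo k (n + 1 + 1))
    refine dvd_add (dvd_sub ?_ ?_) ?_
    · exact ((h1.trans (dvd_pow_self _ two_ne_zero))).mul_left _
    · exact h2.mul_left _
    · exact ((h2.trans (dvd_pow_self _ two_ne_zero))).mul_left _
  exact PowerSeries.X_pow_dvd_iff.1 hd n (by omega)

theorem gfTo_sq (k : ℕ) :
    ((1 - gfFib k) ^ 2 - 4 * PowerSeries.X ^ 2) * gfTo k 0 ^ 2 = 1 := by
  have r := gfTo_rec k 0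
  have s : gfTo k (-1) = gfTo k 1 := by simp only [gfTo, ncard_neg]
  have i := gfInv_zero k
  simp only [gfInv, Nat.cast_zero, zero_add] at i
  simp only [if_true, zero_sub, zero_add, s] at r
  linear_combination (-4 * PowerSeries.X) * i +
    ((1 - gfFib k) * gfTo k 0 + 1 - 2 * PowerSeries.X * gfTo k 1 + 0) * r

/-- Fix a positive integer `k`. For each `n` the set of grand `k`-Fibonacci paths of
length `n` is finite, and the generating function `T* = ∑_{n≥0} |M*_{F_{k,n}}| z^n ∈ ℤ⟦z⟧`
satisfies `((1−(k+1)z−z²)² − 4z²·(1−kz−z²)²)·(T*)² = (1−kz−z²)²`. -/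
theorem grandKFibPath_gf_square (k : ℕ) (hk : 0 < k) :
    (∀ n, (GrandKFibPath k n).Finite) ∧
    (let T : PowerSeries ℤ := PowerSeries.mk fun n => ((GrandKFibPath k n).ncard : ℤ)
     ((1 - ((k : PowerSeries ℤ) + 1) * PowerSeries.X - PowerSeries.X ^ 2) ^ 2
        - 4 * PowerSeries.X ^ 2 *
          (1 - (k : PowerSeries ℤ) * PowerSeries.X - PowerSeries.X ^ 2) ^ 2) * T ^ 2
       = (1 - (k : PowerSeries ℤ) * PowerSeries.X - PowerSeries.X ^ 2) ^ 2) := by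
  refine ⟨fun n => pathsTo_finite k n 0, ?_⟩
  intro T
  have hT : T = gfTo k 0 := rfl
  have h1 := gfTo_sq k
  have h2 := gfFib_eq k
  rw [hT]
  set D := (1 - (k : PowerSeries ℤ) * PowerSeries.X - PowerSeries.X ^ 2) with hD
  have h3 : 1 - ((k : PowerSeries ℤ) + 1) * PowerSeries.X - PowerSeries.X ^ 2
      = D * (1 - gfFib k) := by
    rw [mul_sub, h2, hD]; ring
  rw [h3]
  linear_combination D ^ 2 * h1
end

section
/- Fix a positive integer k and an integer t≥1. The number of grand k-Fibonacci paths of length t equals |M*_{F_{k,t}}| = F_{k+1,t} + ∑ 2^n · (n/(n+2m)) · C(n+2m, m) · C(l+2n+2m, l) · F_{k, t−2n−2m−l+1}^{(l)}, where the sum runs over all integers n≥1, m≥0, l≥0 with 2n+2m+l ≤ t; here F_{k+1,t} is the t-th (k+1)-Fibonacci number, C(a,b) a binomial coefficient, and F_{k,j}^{(l)} a convolved k-Fibonacci number. -/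
namespace GKF

def upw : KStep → ℕ
  | .up => 1
  | .down => 0
  | .horiz _ _ => 0

def dnw : KStep → ℕ
  | .up => 0
  | .down => 1
  | .horiz _ _ => 0

def hzw : KStep → ℕ
  | .up => 0
  | .down => 0
  | .horiz l _ => l

/-- Paths with `u` rises, `d` falls and total horizontal-step width `w`. -/
def S (k u d w : ℕ) : Set (List KStep) :=
  {p | (∀ s ∈ p, s.Valid k) ∧ (p.map upw).sum = u ∧ (p.map dnw).sum = d ∧ (p.map hzw).sum = w}

lemma nil_mem (k u d w : ℕ) : [] ∈ S k u d w ↔ u = 0 ∧ d = 0 ∧ w = 0 := by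
  simp [S, eq_comm]

lemma up_mem (k u d w : ℕ) (p : List KStep) :
    KStep.up :: p ∈ S k u d w ↔ ∃ u', u = u' + 1 ∧ p ∈ S k u' d w := by
  simp only [S, Set.mem_ofPred_eq, List.forall_mem_cons, List.map_cons, List.sum_cons, upw, dnw,
    hzw, KStep.Valid, true_and, zero_add]
  constructor
  · rintro ⟨h1, h2, h3, h4⟩
    exact ⟨_, by omega, h1, rfl, h3, h4⟩
  · rintro ⟨u', h, h1, h2, h3, h4⟩
    exact ⟨h1, by omega, h3, h4⟩

lemma down_mem (k u d w : ℕ) (p : List KStep) :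
    KStep.down :: p ∈ S k u d w ↔ ∃ d', d = d' + 1 ∧ p ∈ S k u d' w := by
  simp only [S, Set.mem_ofPred_eq, List.forall_mem_cons, List.map_cons, List.sum_cons, upw, dnw,
    hzw, KStep.Valid, true_and, zero_add]
  constructor
  · rintro ⟨h1, h2, h3, h4⟩
    exact ⟨_, by omega, h1, h2, rfl, h4⟩
  · rintro ⟨u', h, h1, h2, h3, h4⟩
    exact ⟨h1, h2, by omega, h4⟩

lemma horiz_mem (k u d w l c : ℕ) (p : List KStep) :
    KStep.horiz l c :: p ∈ S k u d w ↔
      1 ≤ c ∧ c ≤ kFib k l ∧ ∃ j, l + j = w ∧ p ∈ S k u d j := by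
  simp only [S, Set.mem_ofPred_eq, List.forall_mem_cons, List.map_cons, List.sum_cons, upw, dnw,
    hzw, KStep.Valid, zero_add]
  constructor
  · rintro ⟨⟨⟨_, h0, h0'⟩, h1⟩, h2, h3, h4⟩
    exact ⟨h0, h0', _, h4, h1, h2, h3, rfl⟩
  · rintro ⟨h0, h0', j, h4, h1, h2, h3, h5⟩
    refine ⟨⟨⟨?_, h0, h0'⟩, h1⟩, h2, h3, by omega⟩
    rcases Nat.eq_zero_or_pos l with rfl | h
    · simp [kFib] at h0'; omega
    · exact h

open Classical in
/-- The paths of `S k u d w` as a finset, built by recursion on an upper bound `N` for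
the number of steps. -/
noncomputable def stepT (T : ℕ → ℕ → ℕ → Finset (List KStep)) (k u d w : ℕ) :
    Finset (List KStep) :=
  (if u = 0 ∧ d = 0 ∧ w = 0 then {[]} else ∅) ∪
  ((if u = 0 then ∅ else (T (u - 1) d w).image (List.cons KStep.up)) ∪
  ((if d = 0 then ∅ else (T u (d - 1) w).image (List.cons KStep.down)) ∪
  ((Finset.HasAntidiagonal.antidiagonal w).biUnion fun ij => (Finset.Icc 1 (kFib k ij.1)).biUnion fun c =>
    (T u d ij.2).image (List.cons (KStep.horiz ij.1 c)))))

lemma mem_stepT (T : ℕ → ℕ → ℕ → Finset (List KStep)) (k u d w : ℕ)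
    (hT : ∀ u' d' w', u' + d' + w' < u + d + w → ∀ p, p ∈ T u' d' w' ↔ p ∈ S k u' d' w')
    (p : List KStep) : p ∈ stepT T k u d w ↔ p ∈ S k u d w := by
  cases p with
  | nil =>
    rw [nil_mem]
    by_cases h : u = 0 ∧ d = 0 ∧ w = 0 <;> by_cases hu : u = 0 <;> by_cases hd : d = 0 <;>
      by_cases hw : w = 0 <;> simp_all [stepT]
  | cons s p =>
    cases s with
    | up =>
      rw [up_mem]
      have : KStep.up :: p ∈ stepT T k u d w ↔ u ≠ 0 ∧ p ∈ T (u - 1) d w := by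
        by_cases h : u = 0 ∧ d = 0 ∧ w = 0 <;> by_cases hu : u = 0 <;> by_cases hd : d = 0 <;>
          by_cases hw : w = 0 <;> simp_all [stepT]
      rw [this]
      rcases u with _ | u
      · simp
      · rw [hT _ _ _ (by omega)]; simp
    | down =>
      rw [down_mem]
      have : KStep.down :: p ∈ stepT T k u d w ↔ d ≠ 0 ∧ p ∈ T u (d - 1) w := by
        by_cases h : u = 0 ∧ d = 0 ∧ w = 0 <;> by_cases hu : u = 0 <;> by_cases hd : d = 0 <;>
          by_cases hw : w = 0 <;> simp_all [stepT]
      rw [this]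
      rcases d with _ | d
      · simp
      · rw [hT _ _ _ (by omega)]; simp
    | horiz l c =>
      rw [horiz_mem]
      have : KStep.horiz l c :: p ∈ stepT T k u d w ↔
          ∃ i j, i + j = w ∧ ∃ c', (1 ≤ c' ∧ c' ≤ kFib k i) ∧ p ∈ T u d j ∧ i = l ∧ c' = c := by
        by_cases h : u = 0 ∧ d = 0 ∧ w = 0 <;> by_cases hu : u = 0 <;> by_cases hd : d = 0 <;>
          simp [stepT, h, hu, hd] <;> grind
      rw [this]
      constructor
      · rintro ⟨i, j, h, c', ⟨h1, h2⟩, h3, rfl, rfl⟩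
        refine ⟨h1, h2, j, h, (hT _ _ _ ?_ _).1 h3⟩
        rcases Nat.eq_zero_or_pos i with rfl | h
        · simp [kFib] at h2; omega
        · omega
      · rintro ⟨h1, h2, j, h, h3⟩
        refine ⟨l, j, h, c, ⟨h1, h2⟩, (hT _ _ _ ?_ _).2 h3, rfl, rfl⟩
        rcases Nat.eq_zero_or_pos l with rfl | h
        · simp [kFib] at h2; omega
        · omega

lemma S_finite (k : ℕ) : ∀ N u d w, u + d + w < N → (S k u d w).Finite := by
  classical
  intro N
  induction N with
  | zero => intro u d w h; omega
  | succ N ih =>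
    intro u d w h
    have := mem_stepT (fun u d w => if h : u + d + w < N then (ih u d w h).toFinset else ∅) k u d w
      (by
        intro u' d' w' h' p
        have : u' + d' + w' < N := by omega
        simp [this])
    refine (Finset.finite_toSet (stepT (fun u d w => if h : u + d + w < N then (ih u d w h).toFinset else ∅) k u d w)).subset (fun p hp => ?_)
    · exact (this p).2 hp

noncomputable def T (k u d w : ℕ) : Finset (List KStep) :=
  (S_finite k (u + d + w + 1) u d w (by omega)).toFinset

lemma mem_T (k u d w : ℕ) (p) : p ∈ T k u d w ↔ p ∈ S k u d w := by simp [T]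

lemma card_T (k u d w : ℕ) : (T k u d w).card =
    (if u = 0 ∧ d = 0 ∧ w = 0 then 1 else 0) +
    ((if u = 0 then 0 else (T k (u - 1) d w).card) +
    ((if d = 0 then 0 else (T k u (d - 1) w).card) +
    ∑ ij ∈ Finset.HasAntidiagonal.antidiagonal w, kFib k ij.1 * (T k u d ij.2).card)) := by
  classical
  have h : T k u d w = stepT (T k) k u d w := by
    ext p
    rw [mem_T, mem_stepT]
    intro u' d' w' _ p
    exact mem_T ..
  rw [h, stepT, Finset.card_union_of_disjoint, Finset.card_union_of_disjoint,
    Finset.card_union_of_disjoint, Finset.card_biUnion]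
  · congr 1
    · split_ifs <;> simp
    · congr 1
      · split_ifs
        · simp
        · rw [Finset.card_image_of_injective _ List.cons_injective]
      · congr 1
        · split_ifs
          · simp
          · rw [Finset.card_image_of_injective _ List.cons_injective]
        · refine Finset.sum_congr rfl fun ij _ => ?_
          rw [Finset.card_biUnion]
          · simp [Finset.card_image_of_injective _ List.cons_injective]
          · intro c _ c' _ hc
            rw [Function.onFun, Finset.disjoint_left]
            intro p hp hp'
            simp only [Finset.mem_image] at hp hp'
            obtain ⟨a, _, rfl⟩ := hp
            obtain ⟨b, _, hb⟩ := hp'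
            simp at hb
            exact hc hb.1.symm
  · intro c hc c' hc' hne
    rw [Function.onFun, Finset.disjoint_left]
    intro p hp hp'
    simp only [Finset.mem_image, Finset.mem_biUnion] at hp hp'
    obtain ⟨_, _, a, _, rfl⟩ := hp
    obtain ⟨_, _, b, _, hb⟩ := hp'
    simp at hb
    have hc := Finset.HasAntidiagonal.mem_antidiagonal.1 (Finset.mem_coe.1 hc)
    have hc' := Finset.HasAntidiagonal.mem_antidiagonal.1 (Finset.mem_coe.1 hc')
    apply hne
    ext <;> omega
  · rw [Finset.disjoint_left]
    intro p hp hp'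
    split_ifs at hp
    · simp at hp
    · simp only [Finset.mem_image, Finset.mem_biUnion] at hp hp'
      obtain ⟨a, _, rfl⟩ := hp
      simp at hp'
  · rw [Finset.disjoint_left]
    intro p hp hp'
    split_ifs at hp
    · simp at hp
    · simp only [Finset.mem_image] at hp
      obtain ⟨a, _, rfl⟩ := hp
      split_ifs at hp' <;> simp at hp'
  · rw [Finset.disjoint_left]
    intro p hp hp'
    split_ifs at hp
    · simp at hp
      subst hp
      split_ifs at hp' <;> simp at hp'
    · simp at hp

open PowerSeries

noncomputable def H (k : ℕ) : PowerSeries ℚ := PowerSeries.mk fun n => (kFib k n : ℚ)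

noncomputable def G (k : ℕ) : PowerSeries ℚ := (1 - H k)⁻¹

lemma constH (k : ℕ) : constantCoeff (H k) = 0 := by
  simp [H, kFib]

lemma G_mul (k : ℕ) : G k * (1 - H k) = 1 := by
  apply PowerSeries.inv_mul_cancel
  simp [constH]

lemma one_sub_ne (k : ℕ) : (1 - H k) ≠ 0 := by
  intro h
  have := G_mul k
  simp [h] at this

noncomputable def P (k u d : ℕ) : PowerSeries ℚ := PowerSeries.mk fun w => ((T k u d w).card : ℚ)

lemma P_rec (k u d : ℕ) : (1 - H k) * P k u d =
    (if u = 0 ∧ d = 0 then 1 else 0) + (if u = 0 then 0 else P k (u - 1) d) +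
      (if d = 0 then 0 else P k u (d - 1)) := by
  have : P k u d = (if u = 0 ∧ d = 0 then 1 else 0) + (if u = 0 then 0 else P k (u - 1) d) +
      (if d = 0 then 0 else P k u (d - 1)) + H k * P k u d := by
    ext w
    rw [map_add, PowerSeries.coeff_mul]
    simp only [P, H, coeff_mk, map_add]
    rw [card_T]
    push_cast
    by_cases hw : w = 0 <;> by_cases hu : u = 0 <;> by_cases hd : d = 0 <;>
      simp [hu, hd, hw, PowerSeries.coeff_one] <;> ring
  linear_combination this

lemma P_eq (k : ℕ) : ∀ u d, P k u d = ((u + d).choose u : PowerSeries ℚ) * G k ^ (u + d + 1) := by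
  suffices ∀ N u d, u + d < N → P k u d = ((u + d).choose u : PowerSeries ℚ) * G k ^ (u + d + 1) from
    fun u d => this _ u d (Nat.lt_succ_self _)
  intro N
  induction N with
  | zero => intro u d h; omega
  | succ N ih =>
    intro u d h
    apply mul_left_cancel₀ (one_sub_ne k)
    rw [P_rec]
    have hG := G_mul k
    rcases u with _ | u <;> rcases d with _ | d
    · simp
      linear_combination - hG
    · simp
      rw [ih 0 d (by omega)]
      simp
      linear_combination - G k ^ (d + 1) * hG
    · simp
      rw [ih u 0 (by omega)]
      simp
      linear_combination - G k ^ (u + 1) * hG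
    · simp
      rw [ih u (d + 1) (by omega), ih (u + 1) d (by omega)]
      have e : (u + 1 + (d + 1)).choose (u + 1) = (u + (d + 1)).choose u + (u + 1 + d).choose (u + 1) := by
        rw [show u + 1 + (d + 1) = (u + (d + 1)) + 1 by ring, Nat.choose_succ_succ]
        congr 2; ring
      rw [e, show u + 1 + d + 1 = u + (d + 1) + 1 by ring]
      push_cast
      rw [show u + 1 + (d + 1) + 1 = (u + (d + 1) + 1) + 1 by ring, pow_succ (G k) (u + (d + 1) + 1)]
      linear_combination - (((u + (d+1)).choose u : PowerSeries ℚ) + ((u + 1 + d).choose (u + 1) : PowerSeries ℚ)) * G k ^ (u + (d + 1) + 1) * hG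

lemma H_D (k : ℕ) : (1 - (k : PowerSeries ℚ) * X - X ^ 2) * H k = X := by
  have : H k = X + X * ((k : PowerSeries ℚ) * H k) + X * (X * H k) := by
    ext n
    rw [← map_natCast (C (R := ℚ))]
    rcases n with _ | _ | n
    · simp [H, kFib]
    · simp only [map_add, coeff_succ_X_mul, coeff_C_mul, H, coeff_mk, coeff_X, kFib]
      simp [kFib]
    · simp only [map_add, coeff_succ_X_mul, coeff_C_mul, H, coeff_mk, coeff_X, kFib]
      simp
  linear_combination this

lemma G_eq (k : ℕ) : G k = 1 + H (k + 1) := by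
  apply mul_right_cancel₀ (one_sub_ne k)
  rw [G_mul]
  have h1 := H_D k
  have h2 := H_D (k + 1)
  push_cast at h2
  have hD : (1 - (k : PowerSeries ℚ) * X - X ^ 2) ≠ 0 := by
    intro h
    rw [h] at h1
    simp at h1
    exact X_ne_zero h1.symm
  apply mul_left_cancel₀ hD
  linear_combination -h2 + (1 + H (k+1)) * h1

lemma geo {R : Type*} [CommRing R] (h : R) (N M : ℕ) :
    (1 - h) * ∑ l ∈ Finset.range (M + 1), ((l + (N + 1)).choose l : R) * h ^ l =
      ∑ l ∈ Finset.range (M + 1), ((l + N).choose l : R) * h ^ l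
        - ((M + N + 1).choose M : R) * h ^ (M + 1) := by
  induction M with
  | zero => simp
  | succ M ih =>
    rw [Finset.sum_range_succ, mul_add, ih, Finset.sum_range_succ _ (M + 1)]
    have e : (M + 1 + (N + 1)).choose (M + 1) = (M + N + 1).choose M + (M + 1 + N).choose (M + 1) := by
      rw [show M + 1 + (N + 1) = (M + N + 1) + 1 by ring, Nat.choose_succ_succ]
      congr 2; ring
    rw [show M + 1 + N + 1 = M + 1 + (N + 1) by ring, e]
    push_cast
    ring

lemma geo_pow {R : Type*} [CommRing R] (h : R) (M N : ℕ) :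
    ∃ r : R, (1 - h) ^ (N + 1) * ∑ l ∈ Finset.range (M + 1), ((l + N).choose l : R) * h ^ l =
      1 + h ^ (M + 1) * r := by
  induction N with
  | zero =>
    refine ⟨-1, ?_⟩
    have := mul_neg_geom_sum h (M + 1)
    simp
    rw [this]; ring
  | succ N ih =>
    obtain ⟨r, hr⟩ := ih
    refine ⟨r - (1 - h) ^ (N + 1) * ((M + N + 1).choose M : R), ?_⟩
    rw [pow_succ, mul_assoc, geo, mul_sub, hr]
    ring

lemma coeff_G_pow (k N w M : ℕ) (hM : w ≤ M) : coeff w (G k ^ (N + 1)) =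
    ∑ l ∈ Finset.range (M + 1), ((l + N).choose l : ℚ) * coeff w (H k ^ l) := by
  obtain ⟨r, hr⟩ := geo_pow (H k) M N
  have h1 : G k ^ (N + 1) * (1 - H k) ^ (N + 1) = 1 := by rw [← mul_pow, G_mul, one_pow]
  have h2 : ∑ l ∈ Finset.range (M + 1), ((l + N).choose l : PowerSeries ℚ) * H k ^ l =
      G k ^ (N + 1) + H k ^ (M + 1) * (r * G k ^ (N + 1)) := by
    linear_combination G k ^ (N + 1) * hr - h1 * ∑ l ∈ Finset.range (M + 1), ((l + N).choose l : PowerSeries ℚ) * H k ^ l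
  have h3 : (X : PowerSeries ℚ) ^ (M + 1) ∣ H k ^ (M + 1) * (r * G k ^ (N + 1)) :=
    Dvd.dvd.mul_right (pow_dvd_pow_of_dvd (X_dvd_iff.2 (constH k)) _) _
  have h4 := congrArg (coeff w) h2
  rw [map_add, X_pow_dvd_iff.1 h3 w (by omega), add_zero, map_sum] at h4
  rw [← h4]
  refine Finset.sum_congr rfl fun l _ => ?_
  rw [← map_natCast (C (R := ℚ)), coeff_C_mul]

lemma coeff_H_pow (k : ℕ) (F : ℕ → ℕ → ℤ)
    (hF : ∀ r : ℕ,
      (1 - (k : PowerSeries ℤ) * PowerSeries.X - PowerSeries.X ^ 2) ^ r *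
        PowerSeries.mk (F r) = 1) (l w : ℕ) :
    coeff w (H k ^ l) = if l ≤ w then (F l (w - l) : ℚ) else 0 := by
  have h := congrArg (PowerSeries.map (Int.castRingHom ℚ)) (hF l)
  simp only [map_mul, map_pow, map_sub, map_one, map_natCast, map_X] at h
  have h2 : H k ^ l = X ^ l * PowerSeries.map (Int.castRingHom ℚ) (PowerSeries.mk (F l)) := by
    have := congrArg (· ^ l) (H_D k)
    simp only [mul_pow] at this
    rw [← this]
    linear_combination - (H k) ^ l * h
  rw [h2, coeff_X_pow_mul']
  simp

lemma ballot (s : ℕ) (hs : 1 ≤ s) (M : ℕ) (hM : M ≤ s) :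
    ∑ m ∈ Finset.range (M + 1), (2 : ℚ) ^ (s - m) *
      (((s - m : ℕ) : ℚ) / (((s - m : ℕ) : ℚ) + 2 * m)) * ((s - m + 2 * m).choose m : ℚ) =
      2 ^ (s - M) * ((s + M).choose M : ℚ) := by
  induction M with
  | zero =>
    have : (s : ℚ) ≠ 0 := by positivity
    simp [this]
  | succ M ih =>
    rw [Finset.sum_range_succ, ih (by omega)]
    obtain ⟨q, rfl⟩ : ∃ q, s = M + 1 + q := ⟨s - (M + 1), by omega⟩
    rw [show M + 1 + q - M = q + 1 by omega, show M + 1 + q - (M + 1) = q by omega]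
    have e : (q + 2 * (M + 1)).choose (M + 1) * (M + 1) = (q + 2 * (M + 1)) * (M + 1 + q + M).choose M := by
      have := Nat.add_one_mul_choose_eq (M + 1 + q + M) M
      rw [show q + 2 * (M + 1) = M + 1 + q + M + 1 by ring]
      exact this.symm
    have e' : ((q + 2 * (M + 1)).choose (M + 1) : ℚ) * (M + 1) = (q + 2 * (M + 1)) * ((M + 1 + q + M).choose M : ℚ) := by
      exact_mod_cast e
    rw [show M + 1 + q + (M + 1) = q + 2 * (M + 1) by ring]
    have hne : (q : ℚ) + 2 * (M + 1) ≠ 0 := by positivity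
    push_cast
    have e2 : ((M + 1 + q + M).choose M : ℚ) = ((q + 2 * (M + 1)).choose (M + 1) : ℚ) * (M + 1) / (q + 2 * (M + 1)) := by
      rw [e']; field_simp
    rw [e2]
    field_simp
    ring

lemma width_eq (p : List KStep) :
    pathWidth p = (p.map upw).sum + (p.map dnw).sum + (p.map hzw).sum := by
  induction p with
  | nil => simp [pathWidth]
  | cons s p ih =>
    simp only [pathWidth, List.map_cons, List.sum_cons] at ih ⊢
    rw [ih]
    cases s <;> simp [KStep.width, upw, dnw, hzw] <;> ring

lemma ht_eq (p : List KStep) :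
    pathHt p = ((p.map upw).sum : ℤ) - ((p.map dnw).sum : ℤ) := by
  induction p with
  | nil => simp [pathHt]
  | cons s p ih =>
    simp only [pathHt, List.map_cons, List.sum_cons] at ih ⊢
    rw [ih]
    cases s <;> simp [KStep.ht, upw, dnw] <;> ring

open Classical in
lemma grand_eq (k t : ℕ) : GrandKFibPath k t =
    (((Finset.range (t + 1)).filter (fun s => 2 * s ≤ t)).biUnion
      fun s => T k s s (t - 2 * s) : Finset (List KStep)) := by
  ext p
  simp only [GrandKFibPath, width_eq, ht_eq, Finset.coe_biUnion, Set.mem_iUnion, Set.mem_ofPred_eq,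
    Finset.mem_coe, mem_T, S, Finset.mem_filter, Finset.mem_range]
  constructor
  · rintro ⟨h1, h2, h3⟩
    exact ⟨(p.map upw).sum, by omega, h1, by omega, by omega, by omega⟩
  · rintro ⟨s, h, h1, h2, h3, h4⟩
    exact ⟨h1, by omega, by omega⟩

lemma grand_card (k t : ℕ) : ((GrandKFibPath k t).ncard : ℚ) =
    ∑ s ∈ Finset.range (t + 1), if 2 * s ≤ t then
      ((s + s).choose s : ℚ) * coeff (t - 2 * s) (G k ^ (s + s + 1)) else 0 := by
  classical
  rw [grand_eq, Set.ncard_coe_finset, Finset.card_biUnion, ← Finset.sum_filter]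
  · push_cast
    refine Finset.sum_congr rfl fun s _ => ?_
    have := congrArg (coeff (t - 2 * s)) (P_eq k s s)
    rw [← map_natCast (C (R := ℚ)), coeff_C_mul] at this
    simpa [P] using this
  · intro s _ s' _ hne
    rw [Function.onFun, Finset.disjoint_left]
    intro p hp hp'
    rw [mem_T] at hp hp'
    exact hne (hp.2.1.symm.trans hp'.2.1)

lemma rearr (t : ℕ) (a : ℕ → ℕ → ℚ) (g : ℕ → ℚ) (hg : ∀ s, t < s → g s = 0)
    (ha : ∀ m, a 0 m = 0) :
    ∑ n ∈ Finset.Icc 1 t, ∑ m ∈ Finset.range (t + 1), a n m * g (n + m) =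
      ∑ s ∈ Finset.Icc 1 t, (∑ m ∈ Finset.range (s + 1), a (s - m) m) * g s := by
  simp_rw [Finset.sum_mul]
  rw [Finset.sum_sigma', Finset.sum_sigma']
  refine Finset.sum_bij_ne_zero (fun x _ _ => ⟨x.1 + x.2, x.2⟩) ?_ ?_ ?_ ?_
  · rintro ⟨n, m⟩ h h'
    have : ¬ t < n + m := fun hh => h' (by simp [hg _ hh])
    simp at h ⊢
    omega
  · rintro ⟨n, m⟩ h h' ⟨n', m'⟩ _ _ he
    simp at he ⊢
    omega
  · rintro ⟨s, m⟩ h h'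
    simp at h h'
    have hne : s - m ≠ 0 := fun hh => h'.1 (by rw [hh]; exact ha m)
    refine ⟨⟨s - m, m⟩, ?_, ?_, ?_⟩
    · simp; omega
    · simp only []
      rw [show s - m + m = s by omega]
      simpa using h'
    · simp; omega
  · rintro ⟨n, m⟩ h h'
    simp

end GKF

/-- Fix a positive integer `k` and an integer `t ≥ 1`. The number of grand `k`-Fibonacci
paths of length `t` equals
`F_{k+1,t} + ∑ 2^n · (n/(n+2m)) · C(n+2m, m) · C(l+2n+2m, l) · F_{k, t−2n−2m−l+1}^{(l)}`,
the sum running over all integers `n ≥ 1`, `m ≥ 0`, `l ≥ 0` with `2n+2m+l ≤ t`.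
Here `F r j = F_{k,j+1}^{(r)}` is the family of convolved `k`-Fibonacci numbers,
characterized by `(1 - kx - x²)^r · ∑_j F_{k,j+1}^{(r)} x^j = 1` in `ℤ⟦x⟧`; the identity
is stated in `ℚ` since the coefficients `n/(n+2m)` are written as fractions. -/
theorem grandKFibPath_card_eq (k : ℕ) (hk : 0 < k) (t : ℕ) (ht : 1 ≤ t) (F : ℕ → ℕ → ℤ)
    (hF : ∀ r : ℕ,
      (1 - (k : PowerSeries ℤ) * PowerSeries.X - PowerSeries.X ^ 2) ^ r *
        PowerSeries.mk (F r) = 1) :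
    (GrandKFibPath k t).Finite ∧
    ((GrandKFibPath k t).ncard : ℚ) = (kFib (k + 1) t : ℚ) +
      ∑ n ∈ Finset.Icc 1 t, ∑ m ∈ Finset.range (t + 1), ∑ l ∈ Finset.range (t + 1),
        (if 2 * n + 2 * m + l ≤ t then
          (2 : ℚ) ^ n * ((n : ℚ) / ((n : ℚ) + 2 * (m : ℚ))) *
            ((n + 2 * m).choose m : ℚ) * ((l + 2 * n + 2 * m).choose l : ℚ) *
            (F l (t - 2 * n - 2 * m - l) : ℚ)
        else 0) := by
  refine ⟨by rw [GKF.grand_eq]; exact Finset.finite_toSet _, ?_⟩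
  set g : ℕ → ℚ := fun s => if 2 * s ≤ t then
    PowerSeries.coeff (t - 2 * s) (GKF.G k ^ (s + s + 1)) else 0 with hgdef
  set a : ℕ → ℕ → ℚ := fun n m => (2 : ℚ) ^ n * ((n : ℚ) / ((n : ℚ) + 2 * (m : ℚ))) *
            ((n + 2 * m).choose m : ℚ) with hadef
  have key : ∀ n m, (∑ l ∈ Finset.range (t + 1), (if 2 * n + 2 * m + l ≤ t then
          (2 : ℚ) ^ n * ((n : ℚ) / ((n : ℚ) + 2 * (m : ℚ))) *
            ((n + 2 * m).choose m : ℚ) * ((l + 2 * n + 2 * m).choose l : ℚ) *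
            (F l (t - 2 * n - 2 * m - l) : ℚ)
        else 0)) = a n m * g (n + m) := by
    intro n m
    by_cases h : 2 * (n + m) ≤ t
    · simp only [hgdef, h, if_true]
      rw [GKF.coeff_G_pow k _ _ t (by omega), Finset.mul_sum]
      refine Finset.sum_congr rfl fun l _ => ?_
      rw [GKF.coeff_H_pow k F hF]
      by_cases hl : 2 * n + 2 * m + l ≤ t
      · rw [if_pos hl, if_pos (by omega), hadef,
          show l + (n + m + (n + m)) = l + 2 * n + 2 * m by ring,
          show t - 2 * (n + m) - l = t - 2 * n - 2 * m - l by omega]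
        ring
      · rw [if_neg hl, if_neg (by omega)]
        simp
    · simp only [hgdef, h, if_false, mul_zero]
      refine Finset.sum_eq_zero fun l _ => ?_
      rw [if_neg (by omega)]
  simp_rw [key]
  rw [GKF.rearr t a g (by intro s hs; simp only [hgdef]; rw [if_neg (by omega)])
    (by intro m; simp [hadef]), GKF.grand_card, Finset.range_eq_Ico,
    Finset.sum_eq_sum_Ico_succ_bot (by omega)]
  congr 1
  · rw [if_pos (by omega)]
    obtain ⟨t, rfl⟩ : ∃ t', t = t' + 1 := ⟨t - 1, by omega⟩
    simp [GKF.G_eq, GKF.H, PowerSeries.coeff_one]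
  · have hI : Finset.Ico (0 + 1) (t + 1) = Finset.Icc 1 t := by ext; simp
    rw [hI]
    refine Finset.sum_congr rfl fun s hs => ?_
    have := GKF.ballot s (Finset.mem_Icc.1 hs).1 s le_rfl
    simp only [hadef, hgdef]
    rw [this]
    simp
end

section
/- Fix a positive integer k and a natural number t. The number of prefix k-Fibonacci paths of length t equals |PM_{F_{k,t}}| = ∑ ((n+1)/(n+m+1)) · ((n+2m+l)!/(m!·l!·(m+n)!)) · F_{k, t−2m−n−l+1}^{(l)}, where the sum runs over all integers n≥0, m≥0, l≥0 with 2m+n+l ≤ t; here (n+2m+l)!/(m!·l!·(m+n)!) is the multinomial coefficient C(n+2m+l; m, l, m+n) and F_{k,j}^{(l)} is a convolved k-Fibonacci number. -/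
namespace KFibAux

open PowerSeries

/-- up indicator -/
def nU : KStep → ℕ
  | .up => 1
  | .down => 0
  | .horiz _ _ => 0
/-- down indicator -/
def nD : KStep → ℕ
  | .up => 0
  | .down => 1
  | .horiz _ _ => 0
/-- horizontal indicator -/
def nH : KStep → ℕ
  | .up => 0
  | .down => 0
  | .horiz _ _ => 1
/-- horizontal width -/
def nW : KStep → ℕ
  | .up => 0
  | .down => 0
  | .horiz l _ => l

/-- total of a statistic -/
def tot (f : KStep → ℕ) (p : List KStep) : ℕ := (p.map f).sum

@[simp] lemma tot_nil (f) : tot f [] = 0 := by simp [tot]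
@[simp] lemma tot_cons (f a p) : tot f (a :: p) = f a + tot f p := by simp [tot]
@[simp] lemma tot_append (f p q) : tot f (p ++ q) = tot f p + tot f q := by simp [tot]

lemma width_eq (p : List KStep) : pathWidth p = tot nU p + tot nD p + tot nW p := by
  induction p with
  | nil => simp [pathWidth]
  | cons a p ih =>
    simp only [pathWidth, List.map_cons, List.sum_cons] at ih ⊢
    rw [ih]
    cases a <;> simp [KStep.width, nU, nD, nW] <;> ring

lemma ht_eq (p : List KStep) : pathHt p = (tot nU p : ℤ) - tot nD p := by
  induction p with
  | nil => simp [pathHt]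
  | cons a p ih =>
    simp only [pathHt, List.map_cons, List.sum_cons] at ih ⊢
    rw [ih]
    cases a <;> simp [KStep.ht, nU, nD] <;> ring

lemma nH_le (k : ℕ) (p : List KStep) (h : ∀ s ∈ p, s.Valid k) : tot nH p ≤ tot nW p := by
  induction p with
  | nil => simp
  | cons a p ih =>
    have h1 := ih (fun s hs => h s (by simp [hs]))
    have h2 := h a (by simp)
    cases a <;> simp [KStep.Valid, nH, nW] at h2 ⊢ <;> omega

/-- good prefix path -/
def Good (k : ℕ) (p : List KStep) : Prop :=
  (∀ s ∈ p, s.Valid k) ∧ (∀ q, q <+: p → 0 ≤ pathHt q)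

/-- refined classes -/
def S (k j u d l : ℕ) (p : List KStep) : Prop :=
  Good k p ∧ tot nU p = u ∧ tot nD p = d ∧ tot nH p = l ∧ tot nW p = j

lemma good_nil (k : ℕ) : Good k [] := by
  refine ⟨by simp, ?_⟩
  intro q hq
  simp at hq
  simp [hq, pathHt]

lemma good_append (k : ℕ) (p : List KStep) (s : KStep) :
    Good k (p ++ [s]) ↔ Good k p ∧ s.Valid k ∧ tot nD (p ++ [s]) ≤ tot nU (p ++ [s]) := by
  have e : 0 ≤ pathHt (p ++ [s]) ↔ tot nD (p ++ [s]) ≤ tot nU (p ++ [s]) := by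
    rw [ht_eq]; omega
  rw [← e]
  unfold Good
  constructor
  · rintro ⟨h1, h2⟩
    refine ⟨⟨fun s hs => h1 s (by simp [hs]), fun q hq => h2 q (hq.trans (by simp))⟩,
      h1 s (by simp), h2 _ (List.prefix_refl _)⟩
  · rintro ⟨⟨h1, h2⟩, h3, h4⟩
    refine ⟨?_, ?_⟩
    · intro a ha
      simp at ha
      rcases ha with ha | rfl
      · exact h1 a ha
      · exact h3
    · intro q hq
      rw [List.prefix_concat_iff] at hq
      rcases hq with rfl | hq
      · exact h4
      · exact h2 q hq

lemma good_le {k p} (h : Good k p) : tot nD p ≤ tot nU p := by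
  have := h.2 p (List.prefix_refl _)
  rw [ht_eq] at this; omega

/-- the generating function of the kFib -/
noncomputable def Phi (k : ℕ) : PowerSeries ℚ := PowerSeries.mk fun i => (kFib k i : ℚ)

/-- multinomial -/
noncomputable def M (u d l : ℕ) : ℚ :=
  ((u + d + l).factorial : ℚ) / ((d.factorial : ℚ) * l.factorial * u.factorial)

/-- ballot coefficient -/
noncomputable def b (u d l : ℕ) : ℚ := ((u : ℚ) + 1 - d) / (u + 1) * M u d l

lemma M_u (u d l : ℕ) : M u d l * (u + 1 + d + l) = M (u + 1) d l * (u + 1) := by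
  unfold M
  rw [show u + 1 + d + l = (u + d + l) + 1 by ring, Nat.factorial_succ, Nat.factorial_succ u]
  push_cast
  field_simp
  ring
lemma M_d (u d l : ℕ) : M u d l * (u + (d + 1) + l) = M u (d + 1) l * (d + 1) := by
  unfold M
  rw [show u + (d + 1) + l = (u + d + l) + 1 by ring, Nat.factorial_succ, Nat.factorial_succ d]
  push_cast
  field_simp
  ring
lemma M_l (u d l : ℕ) : M u d l * (u + d + (l + 1)) = M u d (l + 1) * (l + 1) := by
  unfold M
  rw [show u + d + (l + 1) = (u + d + l) + 1 by ring, Nat.factorial_succ, Nat.factorial_succ l]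
  push_cast
  field_simp
  ring

/-- contributions -/
noncomputable def bU : ℕ → ℕ → ℕ → ℚ
  | 0, _, _ => 0
  | u + 1, d, l => b u d l
/-- contributions -/
noncomputable def bD : ℕ → ℕ → ℕ → ℚ
  | _, 0, _ => 0
  | u, d + 1, l => b u d l
/-- contributions -/
noncomputable def bL : ℕ → ℕ → ℕ → ℚ
  | _, _, 0 => 0
  | u, d, l + 1 => b u d l

lemma bU_eq (u d l : ℕ) (h : d ≤ u) : bU u d l * (u + d + l) = (u - d) * M u d l := by
  cases u with
  | zero =>
    obtain rfl : d = 0 := by omega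
    simp [bU]
  | succ u =>
    have := M_u u d l
    simp only [bU, b]
    push_cast
    have h0 : (u : ℚ) + 1 ≠ 0 := by positivity
    rw [mul_assoc, this]
    field_simp

lemma bD_eq (u d l : ℕ) :
    bD u d l * (u + d + l) = (u + 2 - d) / (u + 1) * d * M u d l := by
  cases d with
  | zero => simp [bD]
  | succ d =>
    have := M_d u d l
    simp only [bD, b]
    push_cast
    rw [mul_assoc, this]
    ring

lemma bL_eq (u d l : ℕ) :
    bL u d l * (u + d + l) = (u + 1 - d) / (u + 1) * l * M u d l := by
  cases l with
  | zero => simp [bL]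
  | succ l =>
    have := M_l u d l
    simp only [bL, b]
    push_cast
    rw [mul_assoc, this]
    ring

lemma b_rec (u d l : ℕ) (h : d ≤ u) (h0 : 0 < u + d + l) :
    bU u d l + bD u d l + bL u d l = b u d l := by
  have hN : (u + d + l : ℚ) ≠ 0 := by exact_mod_cast h0.ne'
  apply mul_right_cancel₀ hN
  rw [add_mul, add_mul, bU_eq u d l h, bD_eq, bL_eq, b]
  have h0 : (u : ℚ) + 1 ≠ 0 := by positivity
  field_simp
  ring

/-- counted predicate -/
def Cnt (P : List KStep → Prop) (x : ℚ) : Prop :=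
  ∃ s : Finset (List KStep), (∀ p, p ∈ s ↔ P p) ∧ (s.card : ℚ) = x

lemma Cnt.image {P Q : List KStep → Prop} {x} (a : KStep) (h : Cnt P x)
    (hQ : ∀ p, Q p ↔ ∃ q, P q ∧ p = q ++ [a]) : Cnt Q x := by
  classical
  obtain ⟨s, hs, hx⟩ := h
  refine ⟨s.image (fun q => q ++ [a]), ?_, ?_⟩
  · intro p
    rw [hQ]
    simp [hs, eq_comm]
  · rw [Finset.card_image_of_injective _ (List.append_left_injective [a]), hx]

lemma Cnt.or {P Q R : List KStep → Prop} {x y} (hP : Cnt P x) (hQ : Cnt Q y)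
    (hd : ∀ p, P p → Q p → False) (hR : ∀ p, R p ↔ P p ∨ Q p) : Cnt R (x + y) := by
  classical
  obtain ⟨s, hs, hx⟩ := hP
  obtain ⟨t, ht, hy⟩ := hQ
  refine ⟨s ∪ t, ?_, ?_⟩
  · intro p
    rw [hR, Finset.mem_union, hs, ht]
  · rw [Finset.card_union_of_disjoint, Nat.cast_add, hx, hy]
    rw [Finset.disjoint_left]
    intro p h1 h2
    exact hd p ((hs p).1 h1) ((ht p).1 h2)

lemma Cnt.sum {ι : Type} (I : Finset ι) (P : ι → List KStep → Prop) (Q : List KStep → Prop)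
    (x : ι → ℚ) (h : ∀ i ∈ I, Cnt (P i) (x i))
    (hd : ∀ i ∈ I, ∀ j ∈ I, ∀ p, P i p → P j p → i = j)
    (hQ : ∀ p, Q p ↔ ∃ i ∈ I, P i p) : Cnt Q (∑ i ∈ I, x i) := by
  classical
  choose! s hs hx using h
  refine ⟨I.biUnion s, ?_, ?_⟩
  · intro p
    rw [hQ, Finset.mem_biUnion]
    constructor
    · rintro ⟨i, hi, hp⟩
      exact ⟨i, hi, (hs i hi p).1 hp⟩
    · rintro ⟨i, hi, hp⟩
      exact ⟨i, hi, (hs i hi p).2 hp⟩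
  · rw [Finset.card_biUnion, Nat.cast_sum]
    · exact Finset.sum_congr rfl hx
    · intro i hi j hj hij
      change Disjoint (s i) (s j)
      rw [Finset.disjoint_left]
      intro p h1 h2
      exact hij (hd i hi j hj p ((hs i hi p).1 h1) ((hs j hj p).1 h2))

lemma Cnt.empty {P : List KStep → Prop} (h : ∀ p, ¬ P p) : Cnt P 0 :=
  ⟨∅, by simpa using h, by simp⟩

lemma S_cnt (k N : ℕ) : ∀ j u d l : ℕ, u + d + l = N → d ≤ u + 1 →
    Cnt (S k j u d l) (b u d l * coeff j (Phi k ^ l)) := by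
  induction N with
  | zero =>
    intro j u d l h _
    obtain ⟨rfl, rfl, rfl⟩ : u = 0 ∧ d = 0 ∧ l = 0 := by omega
    have key : ∀ p, S k j 0 0 0 p ↔ (p = [] ∧ j = 0) := by
      intro p
      constructor
      · rintro ⟨_, h1, h2, h3, h4⟩
        cases p with
        | nil => simpa [eq_comm] using h4
        | cons a p => cases a <;> simp [nU, nD, nH] at h1 h2 h3
      · rintro ⟨rfl, rfl⟩
        exact ⟨good_nil k, by simp⟩
    by_cases hj : j = 0
    · subst hj
      refine ⟨{[]}, by simp [key], by simp [b, M]⟩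
    · have : b 0 0 0 * coeff j (Phi k ^ 0) = 0 := by simp [coeff_one, hj]
      rw [this]
      exact Cnt.empty (by simp [key, hj])
  | succ N ih =>
    intro j u d l h hd
    by_cases hdu : d = u + 1
    · have : b u d l = 0 := by simp [b, hdu]
      rw [this, zero_mul]
      apply Cnt.empty
      rintro p ⟨h1, h2, h3, _⟩
      have := good_le h1
      omega
    have hd' : d ≤ u := by omega
    rw [← b_rec u d l hd' (by omega), add_mul, add_mul]
    have hA : Cnt (fun p => S k j u d l p ∧ ∃ q, p = q ++ [.up])
        (bU u d l * coeff j (Phi k ^ l)) := by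
      cases u with
      | zero =>
        simp only [bU, zero_mul]
        apply Cnt.empty
        rintro p ⟨⟨_, h1, _⟩, q, rfl⟩
        simp [nU] at h1
      | succ u =>
        refine (ih j u d l (by omega) (by omega)).image .up ?_
        intro p
        constructor
        · rintro ⟨⟨hg, h1, h2, h3, h4⟩, q, rfl⟩
          rw [good_append] at hg
          refine ⟨q, ⟨hg.1, ?_⟩, rfl⟩
          simp [nU, nD, nH, nW] at h1 h2 h3 h4
          exact ⟨h1, h2, h3, h4⟩
        · rintro ⟨q, ⟨hg, h1, h2, h3, h4⟩, rfl⟩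
          refine ⟨⟨?_, ?_⟩, q, rfl⟩
          · rw [good_append]
            refine ⟨hg, trivial, ?_⟩
            simp [nU, nD]; omega
          · simp [nU, nD, nH, nW, *]
    have hB : Cnt (fun p => S k j u d l p ∧ ∃ q, p = q ++ [.down])
        (bD u d l * coeff j (Phi k ^ l)) := by
      cases d with
      | zero =>
        simp only [bD, zero_mul]
        apply Cnt.empty
        rintro p ⟨⟨_, _, h1, _⟩, q, rfl⟩
        simp [nD] at h1
      | succ d =>
        refine (ih j u d l (by omega) (by omega)).image .down ?_
        intro p
        constructor
        · rintro ⟨⟨hg, h1, h2, h3, h4⟩, q, rfl⟩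
          rw [good_append] at hg
          refine ⟨q, ⟨hg.1, ?_⟩, rfl⟩
          simp [nU, nD, nH, nW] at h1 h2 h3 h4
          exact ⟨h1, h2, h3, h4⟩
        · rintro ⟨q, ⟨hg, h1, h2, h3, h4⟩, rfl⟩
          refine ⟨⟨?_, ?_⟩, q, rfl⟩
          · rw [good_append]
            refine ⟨hg, trivial, ?_⟩
            simp [nU, nD]; omega
          · simp [nU, nD, nH, nW, *]
    have hC : Cnt (fun p => S k j u d l p ∧ ∃ q i c, p = q ++ [.horiz i c])
        (bL u d l * coeff j (Phi k ^ l)) := by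
      cases l with
      | zero =>
        simp only [bL, zero_mul]
        apply Cnt.empty
        rintro p ⟨⟨_, _, _, h1, _⟩, q, i, c, rfl⟩
        simp [nH] at h1
      | succ l =>
        have e : bL u d (l + 1) * coeff j (Phi k ^ (l + 1)) =
            ∑ x ∈ Finset.HasAntidiagonal.antidiagonal j, ∑ c ∈ Finset.Icc 1 (kFib k x.1),
              b u d l * coeff x.2 (Phi k ^ l) := by
          simp only [bL]
          rw [pow_succ', coeff_mul, Finset.mul_sum]
          refine Finset.sum_congr rfl fun x _ => ?_
          simp [Phi]
          ring
        rw [e]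
        refine Cnt.sum _ (fun x p => ∃ c ∈ Finset.Icc 1 (kFib k x.1), ∃ q,
          S k x.2 u d l q ∧ p = q ++ [.horiz x.1 c]) _ _ ?_ ?_ ?_
        · intro x _
          refine Cnt.sum _ (fun c p => ∃ q, S k x.2 u d l q ∧ p = q ++ [.horiz x.1 c]) _ _ ?_ ?_ ?_
          · intro c _
            exact (ih x.2 u d l (by omega) (by omega)).image (.horiz x.1 c) (fun p => Iff.rfl)
          · rintro c _ c' _ p ⟨q, _, rfl⟩ ⟨q', _, h⟩
            have := (List.append_inj' h rfl).2
            simp at this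
            exact this
          · intro p; rfl
        · rintro x hx y hy p ⟨c, _, q, _, rfl⟩ ⟨c', _, q', _, h⟩
          have := (List.append_inj' h rfl).2
          simp at this
          rw [Finset.HasAntidiagonal.mem_antidiagonal] at hx hy
          ext <;> omega
        · intro p
          constructor
          · rintro ⟨⟨hg, h1, h2, h3, h4⟩, q, i, c, rfl⟩
            rw [good_append] at hg
            obtain ⟨hg1, hg2, -⟩ := hg
            simp [nU, nD, nH, nW] at h1 h2 h3 h4
            simp only [KStep.Valid] at hg2
            refine ⟨(i, tot nW q), by simp [← h4, add_comm], c, by simp; omega, q,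
              ⟨hg1, h1, h2, h3, rfl⟩, rfl⟩
          · rintro ⟨x, hx, c, hc, q, ⟨hg, h1, h2, h3, h4⟩, rfl⟩
            rw [Finset.HasAntidiagonal.mem_antidiagonal] at hx
            rw [Finset.mem_Icc] at hc
            refine ⟨⟨?_, ?_⟩, q, _, _, rfl⟩
            · rw [good_append]
              refine ⟨hg, ⟨?_, hc⟩, ?_⟩
              · by_contra h0
                have : x.1 = 0 := by omega
                rw [this] at hc
                simp [kFib] at hc
                omega
              · simp [nU, nD]; omega
            · simp [nU, nD, nH, nW, h1, h2, h3, h4]; omega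
    refine (hA.or hB ?_ (fun p => Iff.rfl)).or hC ?_ ?_
    · rintro p ⟨_, q, rfl⟩ ⟨_, q', h⟩
      have := (List.append_inj' h rfl).2
      simp at this
    · rintro p (⟨_, q, rfl⟩ | ⟨_, q, rfl⟩) ⟨_, q', i, c, h⟩ <;>
      · have := (List.append_inj' h rfl).2
        simp at this
    · intro p
      constructor
      · intro hp
        rcases List.eq_nil_or_concat p with rfl | ⟨q, a, rfl⟩
        · obtain ⟨_, h1, h2, h3, _⟩ := hp
          simp at h1 h2 h3
          omega
        · cases a with
          | up => exact Or.inl (Or.inl ⟨hp, q, by simp⟩)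
          | down => exact Or.inl (Or.inr ⟨hp, q, by simp⟩)
          | horiz i c => exact Or.inr ⟨hp, q, i, c, by simp⟩
      · rintro ((h | h) | h) <;> exact h.1

lemma Phi_mul (k : ℕ) : Phi k * (1 - (k : PowerSeries ℚ) * X - X ^ 2) = X := by
  have hk : (k : PowerSeries ℚ) = C (k : ℚ) := by simp
  ext n
  rw [mul_sub, mul_sub, mul_one, hk, ← mul_assoc, mul_comm (Phi k) (C _), mul_assoc]
  rcases n with _ | _ | n
  · simp [Phi, kFib]
  · simp only [map_sub, coeff_C_mul, coeff_succ_mul_X, coeff_mul_X_pow']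
    simp [Phi, kFib]
  · simp only [map_sub, coeff_C_mul, coeff_succ_mul_X, coeff_mul_X_pow']
    simp [Phi, kFib, coeff_X]

lemma Phi_pow (k : ℕ) (F : ℕ → ℕ → ℤ)
    (hF : ∀ r : ℕ,
      (1 - (k : PowerSeries ℤ) * PowerSeries.X - PowerSeries.X ^ 2) ^ r *
        PowerSeries.mk (F r) = 1) (l j : ℕ) (h : l ≤ j) :
    coeff j (Phi k ^ l) = (F l (j - l) : ℚ) := by
  have h1 := congrArg (PowerSeries.map (Int.castRingHom ℚ)) (hF l)
  simp only [map_mul, map_pow, map_sub, map_one, map_natCast, PowerSeries.map_X] at h1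
  have h2 : Phi k ^ l = X ^ l * PowerSeries.map (Int.castRingHom ℚ) (PowerSeries.mk (F l)) := by
    rw [← Phi_mul k, mul_pow, mul_assoc, h1, mul_one]
  rw [h2, coeff_X_pow_mul', if_pos h]
  simp

end KFibAux

open KFibAux

/-- Fix a positive integer `k` and a natural number `t`. The number of prefix
`k`-Fibonacci paths of length `t` equals
`∑ ((n+1)/(n+m+1)) · ((n+2m+l)!/(m!·l!·(m+n)!)) · F_{k, t−2m−n−l+1}^{(l)}`,
the sum running over all integers `n ≥ 0`, `m ≥ 0`, `l ≥ 0` with `2m+n+l ≤ t`.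
Here `F r j = F_{k,j+1}^{(r)}` is the family of convolved `k`-Fibonacci numbers,
characterized by `(1 - kx - x²)^r · ∑_j F_{k,j+1}^{(r)} x^j = 1` in `ℤ⟦x⟧`; the identity
is stated in `ℚ` since the coefficients are written as fractions. -/
theorem prefixKFibPath_card_eq (k : ℕ) (hk : 0 < k) (t : ℕ) (F : ℕ → ℕ → ℤ)
    (hF : ∀ r : ℕ,
      (1 - (k : PowerSeries ℤ) * PowerSeries.X - PowerSeries.X ^ 2) ^ r *
        PowerSeries.mk (F r) = 1) :
    (PrefixKFibPath k t).Finite ∧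
    ((PrefixKFibPath k t).ncard : ℚ) =
      ∑ n ∈ Finset.range (t + 1), ∑ m ∈ Finset.range (t + 1), ∑ l ∈ Finset.range (t + 1),
        (if 2 * m + n + l ≤ t then
          (((n : ℚ) + 1) / ((n : ℚ) + (m : ℚ) + 1)) *
            ((Nat.factorial (n + 2 * m + l) : ℚ) /
              ((Nat.factorial m : ℚ) * (Nat.factorial l : ℚ) * (Nat.factorial (m + n) : ℚ))) *
            (F l (t - 2 * m - n - l) : ℚ)
        else 0) := by
  have key : Cnt (fun p => p ∈ PrefixKFibPath k t)
      (∑ x ∈ (Finset.range (t + 1) ×ˢ Finset.range (t + 1) ×ˢ Finset.range (t + 1)).filter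
        (fun x => 2 * x.2.1 + x.1 + x.2.2 ≤ t),
        b (x.2.1 + x.1) x.2.1 x.2.2 *
          PowerSeries.coeff (t - 2 * x.2.1 - x.1) (Phi k ^ x.2.2)) := by
    refine Cnt.sum _ (fun x => S k (t - 2 * x.2.1 - x.1) (x.2.1 + x.1) x.2.1 x.2.2) _ _ ?_ ?_ ?_
    · intro x _
      exact S_cnt k _ _ _ _ _ rfl (by omega)
    · rintro ⟨n, m, l⟩ _ ⟨n', m', l'⟩ _ p ⟨_, h1, h2, h3, _⟩ ⟨_, h1', h2', h3', _⟩
      simp only at h1 h2 h3 h1' h2' h3'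
      simp only [Prod.mk.injEq]
      omega
    · intro p
      simp only [Finset.mem_filter, Finset.mem_product, Finset.mem_range]
      constructor
      · rintro ⟨h1, h2, h3⟩
        have hg : Good k p := ⟨h1, h3⟩
        have a1 := good_le hg
        have a2 := nH_le k p h1
        rw [width_eq] at h2
        refine ⟨(tot nU p - tot nD p, tot nD p, tot nH p), ?_, hg, ?_, rfl, rfl, ?_⟩
        · simp only
          omega
        · simp only
          omega
        · simp only
          omega
      · rintro ⟨⟨n, m, l⟩, hx, ⟨hg1, hg2⟩, h1, h2, h3, h4⟩
        simp only at hx h1 h2 h3 h4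
        refine ⟨hg1, ?_, hg2⟩
        rw [width_eq]
        omega
  obtain ⟨s, hs, hc⟩ := key
  have hset : PrefixKFibPath k t = ↑s := by
    ext p
    simp [hs]
  rw [hset]
  refine ⟨s.finite_toSet, ?_⟩
  rw [Set.ncard_coe_finset, hc, Finset.sum_filter, Finset.sum_product]
  refine Finset.sum_congr rfl fun n _ => ?_
  rw [Finset.sum_product]
  refine Finset.sum_congr rfl fun m _ => Finset.sum_congr rfl fun l _ => ?_
  simp only
  split_ifs with h
  · rw [Phi_pow k F hF _ _ (by omega), b, M]
    rw [show m + n + m + l = n + 2 * m + l by ring]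
    push_cast
    rw [show (m : ℚ) + n + 1 - m = n + 1 by ring, show (m : ℚ) + n + 1 = n + m + 1 by ring]
  · rfl
end

section
/- For each n, the set of Motzkin paths of length n is finite; let m_n be its cardinality (the n-th Motzkin number) and let M = ∑_{n≥0} m_n z^n ∈ ℤ⟦z⟧. Then M satisfies the quadratic equation z^2·M^2 − (1−z)·M + 1 = 0. -/
/-- A step of a Motzkin path: a rise `U = (1,1)`, a fall `D = (1,-1)`,
or a horizontal step `H = (1,0)`. -/
inductive MStep where
  | up : MStep
  | down : MStep
  | level : MStep

/-- Height contribution of a Motzkin step. -/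
def MStep.ht : MStep → ℤ
  | .up => 1
  | .down => -1
  | .level => 0

/-- Final height of a sequence of Motzkin steps. -/
def mPathHt (p : List MStep) : ℤ := (p.map MStep.ht).sum

/-- Motzkin paths of length `n`: sequences of `n` steps from `{U, D, H}` whose partial
height sums are always nonnegative and whose final height is `0`. -/
def MotzkinPath (n : ℕ) : Set (List MStep) :=
  {p | p.length = n ∧ (∀ q, q <+: p → 0 ≤ mPathHt q) ∧ mPathHt p = 0}

/-- Paths of length `n` from height `h` to height `0` staying nonnegative. -/
def MWalk (n : ℕ) (h : ℤ) : Set (List MStep) :=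
  {p | p.length = n ∧ (∀ q, q <+: p → 0 ≤ h + mPathHt q) ∧ h + mPathHt p = 0}

theorem mPathHt_cons (a : MStep) (p : List MStep) : mPathHt (a :: p) = a.ht + mPathHt p := by
  simp [mPathHt]

theorem mPathHt_nil : mPathHt [] = 0 := by
  simp [mPathHt]

theorem MWalk_neg (n : ℕ) (h : ℤ) (hh : h < 0) : MWalk n h = ∅ := by
  ext p
  simp only [MWalk, Set.mem_ofPred_eq, Set.mem_empty_iff_false, iff_false]
  rintro ⟨-, h2, -⟩
  have := h2 [] List.nil_prefix
  rw [mPathHt_nil] at this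
  omega

theorem MWalk_cons (n : ℕ) (h : ℤ) (hh : 0 ≤ h) (a : MStep) (p : List MStep) :
    a :: p ∈ MWalk (n + 1) h ↔ p ∈ MWalk n (h + a.ht) := by
  simp only [MWalk, Set.mem_ofPred_eq, List.length_cons, add_left_inj, mPathHt_cons, add_assoc]
  refine and_congr_right fun _ => and_congr_left fun _ => ⟨fun H q hq => ?_, fun H q hq => ?_⟩
  · have := H (a :: q) (by simpa using hq)
    rwa [mPathHt_cons] at this
  · rcases List.prefix_cons_iff.1 hq with rfl | ⟨t, rfl, ht⟩
    · simpa [mPathHt_nil] using hh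
    · rw [mPathHt_cons]
      exact H t ht

theorem MWalk_succ (n : ℕ) (h : ℤ) (hh : 0 ≤ h) :
    MWalk (n + 1) h = (Set.image (List.cons MStep.up) (MWalk n (h + 1)) ∪
      Set.image (List.cons MStep.level) (MWalk n h)) ∪ Set.image (List.cons MStep.down) (MWalk n (h - 1)) := by
  ext p
  cases p with
  | nil => simp [MWalk]
  | cons a p =>
    rw [MWalk_cons n h hh]
    cases a <;> simp [MStep.ht, sub_eq_add_neg]

theorem MWalk_zero (h : ℤ) : MWalk 0 h = if h = 0 then {[]} else ∅ := by
  ext p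
  by_cases hh : h = 0
  · simp only [MWalk, Set.mem_ofPred_eq, hh, if_true, Set.mem_singleton_iff, List.length_eq_zero_iff]
    constructor
    · exact fun H => H.1
    · rintro rfl
      simp [mPathHt_nil]
  · simp only [MWalk, Set.mem_ofPred_eq, hh, if_false, Set.mem_empty_iff_false, iff_false,
      List.length_eq_zero_iff]
    rintro ⟨rfl, -, h3⟩
    simp [mPathHt_nil] at h3
    exact hh h3

theorem MWalk_finite (n : ℕ) : ∀ h, (MWalk n h).Finite := by
  induction n with
  | zero =>
    intro h
    rw [MWalk_zero]
    split_ifs <;> simp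
  | succ n ih =>
    intro h
    by_cases hh : 0 ≤ h
    · rw [MWalk_succ n h hh]
      exact (((ih _).image _).union ((ih _).image _)).union ((ih _).image _)
    · rw [MWalk_neg _ _ (by omega)]
      exact Set.finite_empty

theorem MWalk_ncard_succ (n : ℕ) (h : ℤ) (hh : 0 ≤ h) :
    (MWalk (n + 1) h).ncard =
      (MWalk n (h + 1)).ncard + (MWalk n h).ncard + (MWalk n (h - 1)).ncard := by
  have f := MWalk_finite n
  rw [MWalk_succ n h hh, Set.ncard_union_eq _ (((f _).image _).union ((f _).image _))
    ((f _).image _), Set.ncard_union_eq _ ((f _).image _) ((f _).image _),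
    Set.ncard_image_of_injective _ List.cons_injective,
    Set.ncard_image_of_injective _ List.cons_injective,
    Set.ncard_image_of_injective _ List.cons_injective]
  · rw [Set.disjoint_left]
    rintro _ ⟨p, -, rfl⟩ ⟨q, -, hq⟩
    simp at hq
  · rw [Set.disjoint_left]
    rintro _ (⟨p, -, rfl⟩ | ⟨p, -, rfl⟩) ⟨q, -, hq⟩ <;> simp at hq

/-- Generating function of walks from height `h` to `0`. -/
noncomputable def MGF (h : ℕ) : PowerSeries ℤ :=
  PowerSeries.mk fun n => ((MWalk n (h : ℤ)).ncard : ℤ)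

theorem MGF_zero : MGF 0 = 1 + PowerSeries.X * (MGF 1 + MGF 0) := by
  ext n
  cases n with
  | zero => simp [MGF, MWalk_zero]
  | succ n =>
    have := MWalk_ncard_succ n 0 le_rfl
    rw [MWalk_neg n (0 - 1) (by norm_num)] at this
    simp [MGF, PowerSeries.coeff_succ_X_mul, PowerSeries.coeff_one, this]

theorem MGF_succ (h : ℕ) :
    MGF (h + 1) = PowerSeries.X * (MGF (h + 2) + MGF (h + 1) + MGF h) := by
  ext n
  cases n with
  | zero =>
    have : (h : ℤ) + 1 ≠ 0 := by omega
    simp [MGF, MWalk_zero, this]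
  | succ n =>
    have := MWalk_ncard_succ n (h + 1) (by omega)
    rw [add_sub_cancel_right, add_assoc (h : ℤ) 1 1, one_add_one_eq_two] at this
    simp [MGF, PowerSeries.coeff_succ_X_mul, this]

theorem MGF_mul (n : ℕ) : ∀ h, PowerSeries.coeff n (MGF (h + 1)) =
    PowerSeries.coeff n (PowerSeries.X * MGF 0 * MGF h) := by
  induction n with
  | zero =>
    intro h
    rw [MGF_succ, mul_assoc]
    simp
  | succ n ih =>
    intro h
    cases h with
    | zero =>
      have e : PowerSeries.X * MGF 0 * MGF 0 = PowerSeries.X *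
          (PowerSeries.X * MGF 0 * MGF 1 + PowerSeries.X * MGF 0 * MGF 0 + MGF 0) := by
        linear_combination (PowerSeries.X * MGF 0) * MGF_zero
      rw [MGF_succ 0, e, PowerSeries.coeff_succ_X_mul, PowerSeries.coeff_succ_X_mul]
      simp only [map_add, ← ih]
    | succ h =>
      have e : PowerSeries.X * MGF 0 * MGF (h + 1) = PowerSeries.X *
          (PowerSeries.X * MGF 0 * MGF (h + 2) + PowerSeries.X * MGF 0 * MGF (h + 1)
            + PowerSeries.X * MGF 0 * MGF h) := by
        linear_combination (PowerSeries.X * MGF 0) * MGF_succ h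
      rw [MGF_succ (h + 1), e, PowerSeries.coeff_succ_X_mul, PowerSeries.coeff_succ_X_mul]
      simp only [map_add, ← ih]

theorem MotzkinPath_eq (n : ℕ) : MotzkinPath n = MWalk n 0 := by
  simp [MotzkinPath, MWalk]

/-- For each `n` the set of Motzkin paths of length `n` is finite, and the generating
function `M = ∑_{n≥0} m_n z^n ∈ ℤ⟦z⟧` of the Motzkin numbers satisfies
`z²·M² − (1−z)·M + 1 = 0`. -/
theorem motzkin_gf_quadratic :
    (∀ n, (MotzkinPath n).Finite) ∧
    (let M : PowerSeries ℤ := PowerSeries.mk fun n => ((MotzkinPath n).ncard : ℤ)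
     PowerSeries.X ^ 2 * M ^ 2 - (1 - PowerSeries.X) * M + 1 = 0) := by
  refine ⟨fun n => MotzkinPath_eq n ▸ MWalk_finite n 0, ?_⟩
  intro M
  have hM : M = MGF 0 := by
    simp [M, MGF, MotzkinPath_eq]
  have h1 : MGF 1 = PowerSeries.X * MGF 0 * MGF 0 := by
    ext n
    exact MGF_mul n 0
  rw [hM]
  linear_combination (-1 : PowerSeries ℤ) * MGF_zero - PowerSeries.X * h1
end
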